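/- arXiv:math/0506564 — 2 statements merged into one kernel-verified Lean document; each statement's English description precedes it below -/
import Mathlib

section
/- Every n-dimensional polytope P in R^N admits a starring at any point a ∈ P; that is, there is a triangulation of P into n-simplices each of which has a vertex at a. -/
open Set MeasureTheory
open scoped Classical
noncomputable section

/-- Ambient Euclidean space `ℝ^N`. -/
abbrev Euc (N : ℕ) := EuclideanSpace ℝ (Fin N)

/-- `s` is an `n`-simplex: the convex hull of `n+1` affinely independent points. -/
def IsSimplex {N : ℕ} (n : ℕ) (s : Set (Euc N)) : Prop :=
  ∃ v : Fin (n + 1) → Euc N, AffineIndependent ℝ v ∧ s = convexHull ℝ (Set.range v)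

/-- The (affine) dimension of a set: the rank of its vector span. -/
def sdim {N : ℕ} (s : Set (Euc N)) : ℕ := Module.finrank ℝ (vectorSpan ℝ s)

/-- A polytope: the compact convex hull of finitely many points (nonempty). -/
def IsPolytope {N : ℕ} (s : Set (Euc N)) : Prop :=
  ∃ t : Finset (Euc N), t.Nonempty ∧ s = convexHull ℝ (t : Set (Euc N))

/-- An `n`-polyhedron: a finite union of `n`-dimensional polytopes. -/
def IsPolyhedron {N : ℕ} (n : ℕ) (P : Set (Euc N)) : Prop :=
  ∃ F : Finset (Set (Euc N)), F.Nonempty ∧ (∀ Q ∈ F, IsPolytope Q ∧ sdim Q = n) ∧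
    (⋃ Q ∈ F, Q) = P

/-- A triangulation of the `n`-dimensional set `P`: a finite set of `n`-simplices with
union `P`, any two distinct ones intersecting in a set of dimension less than `n`. -/
def IsTriangulation {N : ℕ} (n : ℕ) (P : Set (Euc N)) (F : Finset (Set (Euc N))) : Prop :=
  (∀ T ∈ F, IsSimplex n T) ∧ (⋃ T ∈ F, T) = P ∧
    ∀ S ∈ F, ∀ T ∈ F, S ≠ T → sdim (S ∩ T) < n

/-- A starring of `P` at `a`: a triangulation all of whose simplices have a vertex at `a`. -/
def IsStarring {N : ℕ} (n : ℕ) (P : Set (Euc N)) (a : Euc N) (F : Finset (Set (Euc N))) : Prop :=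
  IsTriangulation n P F ∧
    ∀ T ∈ F, ∃ v : Fin (n + 1) → Euc N, AffineIndependent ℝ v ∧
      T = convexHull ℝ (Set.range v) ∧ a ∈ Set.range v

/-- `T` is dissected into the two `n`-simplices `T₁, T₂` by a hyperplane containing an
`(n-2)`-dimensional face of `T`. -/
def IsDissection {N : ℕ} (n : ℕ) (T T₁ T₂ : Set (Euc N)) : Prop :=
  IsSimplex n T₁ ∧ IsSimplex n T₂ ∧ T₁ ∪ T₂ = T ∧ T₁ ≠ T₂ ∧
  ∃ (f : Euc N →ₗ[ℝ] ℝ) (c : ℝ), f ≠ 0 ∧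
    T₁ = T ∩ {x | f x ≤ c} ∧ T₂ = T ∩ {x | c ≤ f x} ∧
    ∃ v : Fin (n + 1) → Euc N, AffineIndependent ℝ v ∧ T = convexHull ℝ (Set.range v) ∧
      ∃ s : Finset (Fin (n + 1)), s.card = n - 1 ∧ ∀ i ∈ s, f (v i) = c

/-- An elementary move: dissect one simplex of the triangulation into two `n`-simplices by a
hyperplane containing an `(n-2)`-face, or merge two simplices whose union is again a simplex. -/
def ElemMove {N : ℕ} (n : ℕ) (F G : Finset (Set (Euc N))) : Prop :=
  (∃ T ∈ F, ∃ T₁ T₂, IsDissection n T T₁ T₂ ∧ G = insert T₁ (insert T₂ (F.erase T))) ∨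
  (∃ T₁ ∈ F, ∃ T₂ ∈ F, T₁ ≠ T₂ ∧ IsSimplex n (T₁ ∪ T₂) ∧
    G = insert (T₁ ∪ T₂) ((F.erase T₁).erase T₂))

/-- Equivalence by finitely many elementary moves. -/
def MoveEquiv {N : ℕ} (n : ℕ) (F G : Finset (Set (Euc N))) : Prop :=
  Relation.ReflTransGen (ElemMove n) F G

/-- `μ` is a valuation on the class `S` of sets. -/
def IsValuation {N : ℕ} (S : Set (Set (Euc N))) (μ : Set (Euc N) → ℝ) : Prop :=
  μ ∅ = 0 ∧ ∀ A ∈ S, ∀ B ∈ S, A ∪ B ∈ S → A ∩ B ∈ S →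
    μ A + μ B = μ (A ∪ B) + μ (A ∩ B)

/-- `𝒯ⁿ`: simplices of dimension at most `n` (together with `∅`). -/
def simplexClass (N n : ℕ) : Set (Set (Euc N)) :=
  {s | s = ∅ ∨ ∃ k ≤ n, IsSimplex k s}

/-- `𝒫ⁿ`: polytopes of dimension at most `n` (together with `∅`). -/
def polytopeClass (N n : ℕ) : Set (Set (Euc N)) :=
  {s | s = ∅ ∨ (IsPolytope s ∧ sdim s ≤ n)}

/-- `𝒬ⁿ`: polyhedra (finite unions of polytopes) of dimension at most `n` (with `∅`). -/
def polyhedronClass (N n : ℕ) : Set (Set (Euc N)) :=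
  {s | s = ∅ ∨ ((∃ F : Finset (Set (Euc N)), F.Nonempty ∧ (∀ Q ∈ F, IsPolytope Q) ∧
      (⋃ Q ∈ F, Q) = s) ∧ sdim s ≤ n)}



/-! ### Auxiliary lemmas -/

/-- Points outside finitely many affine subspaces are dense in a convex set. -/
lemma dense_generic {V κ : Type*} [NormedAddCommGroup V] [NormedSpace ℝ V]
    {P : Set V} (hP : Convex ℝ P) (H : κ → AffineSubspace ℝ V) (s : Finset κ)
    (hs : ∀ k ∈ s, ∃ z ∈ P, z ∉ H k) (x : V) (hx : x ∈ P) (U : Set V) (hU : IsOpen U)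
    (hxU : x ∈ U) : ∃ y ∈ P, y ∈ U ∧ ∀ k ∈ s, y ∉ H k := by
  induction s using Finset.induction_on with
  | empty => exact ⟨x, hx, hxU, by simp⟩
  | insert k s hk ih =>
    obtain ⟨y, hyP, hyU, hy⟩ := ih (fun k hk => hs k (Finset.mem_insert_of_mem hk))
    obtain ⟨z, hzP, hz⟩ := hs k (Finset.mem_insert_self _ _)
    have key : ∀ L : AffineSubspace ℝ V, (y ∉ L ∨ z ∉ L) →
        ∀ᶠ r : ℝ in nhdsWithin 0 (Set.Ioi 0), AffineMap.lineMap y z r ∉ L := by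
      intro L hL
      have hsub : {r : ℝ | AffineMap.lineMap y z r ∈ L}.Subsingleton := by
        intro r hr r' hr'
        by_contra hne
        have hall : ∀ u : ℝ, AffineMap.lineMap y z u ∈ L := by
          intro u
          have : AffineMap.lineMap y z u = AffineMap.lineMap (AffineMap.lineMap y z r : V)
              (AffineMap.lineMap y z r') ((u - r) / (r' - r)) := by
            have h1 : r' - r ≠ 0 := sub_ne_zero.2 (Ne.symm hne)
            rw [← AffineMap.apply_lineMap]
            congr 1
            rw [AffineMap.lineMap_apply_ring']
            field_simp
            ring
          rw [this]
          exact AffineMap.lineMap_mem _ hr hr'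
        rcases hL with h | h
        · exact h (by simpa using hall 0)
        · exact h (by simpa using hall 1)
      have hfin := hsub.finite
      have hc : ({r : ℝ | AffineMap.lineMap y z r ∈ L} \ {0})ᶜ ∈ nhds (0 : ℝ) :=
        (hfin.subset Set.sdiff_subset).isClosed.isOpen_compl.mem_nhds (by simp)
      filter_upwards [nhdsWithin_le_nhds hc, self_mem_nhdsWithin] with r hr hr0 hrL
      exact hr ⟨hrL, by simpa using (ne_of_gt hr0)⟩
    have hev : ∀ᶠ r : ℝ in nhdsWithin 0 (Set.Ioi 0), ∀ k' ∈ insert k s,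
        AffineMap.lineMap y z r ∉ H k' := by
      rw [Filter.eventually_all_finset]
      intro k' hk'
      apply key
      rcases Finset.mem_insert.1 hk' with rfl | h
      · exact Or.inr hz
      · exact Or.inl (hy k' h)
    have hopen : ∀ᶠ r : ℝ in nhdsWithin 0 (Set.Ioi 0), AffineMap.lineMap y z r ∈ U := by
      apply nhdsWithin_le_nhds
      have hcont : Continuous (fun r : ℝ => (AffineMap.lineMap y z r : V)) :=
        AffineMap.lineMap_continuous
      exact hcont.continuousAt.preimage_mem_nhds (hU.mem_nhds (by simpa using hyU))
    have h01 : ∀ᶠ r : ℝ in nhdsWithin 0 (Set.Ioi 0), r ∈ Set.Ioo (0 : ℝ) 1 :=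
      Ioo_mem_nhdsGT one_pos
    obtain ⟨r, h1, h2, h3⟩ := (hev.and (hopen.and h01)).exists
    exact ⟨_, hP.lineMap_mem hyP hzP ⟨h3.1.le, h3.2.le⟩, h2, h1⟩

/-- Existence of an affine function with prescribed values on affinely independent points. -/
lemma exists_affine_interp {V κ : Type*} [AddCommGroup V] [Module ℝ V]
    (z : κ → V) (hz : AffineIndependent ℝ z) (y : κ → ℝ) :
    ∃ g : V →ᵃ[ℝ] ℝ, ∀ k, g (z k) = y k := by
  rcases isEmpty_or_nonempty κ with h | ⟨⟨k0⟩⟩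
  · exact ⟨AffineMap.const ℝ V 0, fun k => h.elim k⟩
  have hl := (affineIndependent_iff_linearIndependent_vsub ℝ z k0).1 hz
  obtain ⟨L, hL⟩ := LinearMap.exists_leftInverse_of_injective _ (linearIndependent_iff_ker.1 hl)
  let f : V →ₗ[ℝ] ℝ :=
    (Finsupp.linearCombination ℝ (fun i : {x // x ≠ k0} => y i - y k0)) ∘ₗ L
  refine ⟨f.toAffineMap.comp (AffineMap.id ℝ V - AffineMap.const ℝ V (z k0))
    + AffineMap.const ℝ V (y k0), fun k => ?_⟩
  by_cases hk : k = k0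
  · subst hk; simp
  · have h1 : L (z k - z k0) = Finsupp.single ⟨k, hk⟩ 1 := by
      have := LinearMap.congr_fun hL (Finsupp.single (⟨k, hk⟩ : {x // x ≠ k0}) 1)
      simpa using this
    have h2 : f (z k - z k0) = y k - y k0 := by
      simp [f, h1, -map_sub]
    have h3 : f (z k) - f (z k0) = y k - y k0 := by rw [← map_sub, h2]
    simp [h3]

/-- Perturbing a convex combination with positive weights stays in the convex set. -/
lemma perturb_mem {V κ : Type*} [AddCommGroup V] [Module ℝ V] [Fintype κ]
    {C : Set V} (hC : Convex ℝ C) (z : κ → V) (hz : ∀ k, z k ∈ C) (q : V) (hq : q ∈ C)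
    (l : κ → ℝ) (hl : ∀ k, 0 < l k) (hl1 : ∑ k, l k = 1) (v : κ → ℝ) (c : ℝ) (hc : 0 ≤ c)
    (hv : ∑ k, v k + c = 0) :
    ∃ e : ℝ, 0 < e ∧ ∑ k, l k • z k + e • (∑ k, v k • z k + c • q) ∈ C := by
  have hev : ∀ᶠ e : ℝ in nhdsWithin 0 (Set.Ioi 0), ∀ k, 0 < l k + e * v k := by
    rw [Filter.eventually_all]
    intro k
    apply nhdsWithin_le_nhds
    have hcont : Continuous (fun e : ℝ => l k + e * v k) := by fun_prop
    exact hcont.continuousAt.preimage_mem_nhds (isOpen_Ioi.mem_nhds (by simpa using hl k))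
  obtain ⟨e, he, he0⟩ := (hev.and self_mem_nhdsWithin).exists
  have he0 : 0 < e := he0
  refine ⟨e, he0, ?_⟩
  have := hC.sum_mem (t := (Finset.univ : Finset (Option κ)))
    (w := fun o => o.elim (e * c) (fun k => l k + e * v k))
    (z := fun o => o.elim q z) ?_ ?_ ?_
  · convert this using 1
    rw [Fintype.sum_option]
    simp only [Option.elim, add_smul, Finset.sum_add_distrib, smul_add, Finset.smul_sum, smul_smul]
    abel
  · rintro (_ | k) _
    · exact mul_nonneg he0.le hc
    · exact (he k).le
  · rw [Fintype.sum_option]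
    simp only [Option.elim, Finset.sum_add_distrib, hl1, ← Finset.mul_sum]
    linear_combination e * hv
  · rintro (_ | k) _
    · exact hq
    · exact hz k

/-- Linear functional measuring the gap between a height and the interpolated height. -/
lemma exists_gap {V ι : Type*} [AddCommGroup V] [Module ℝ V] [Fintype ι]
    (p : ι → V) (s : Finset ι) (j : ι) (hj : j ∉ s)
    (hp : p j ∈ affineSpan ℝ (p '' (s : Set ι))) :
    ∃ f : (ι → ℝ) →ₗ[ℝ] ℝ, f (Pi.single j 1) = 1 ∧
      ∀ (h : ι → ℝ) (g : V →ᵃ[ℝ] ℝ), (∀ i ∈ s, g (p i) = h i) → f h = h j - g (p j) := by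
  obtain ⟨t, w, hts, hw, he⟩ := eq_affineCombination_of_mem_affineSpan_image hp
  refine ⟨(LinearMap.proj j : (ι → ℝ) →ₗ[ℝ] ℝ) -
      ∑ i ∈ t, w i • (LinearMap.proj i : (ι → ℝ) →ₗ[ℝ] ℝ), ?_, ?_⟩
  · have : ∑ i ∈ t, w i * (Pi.single j (1 : ℝ) : ι → ℝ) i = 0 := by
      apply Finset.sum_eq_zero
      intro i hi
      have : i ≠ j := by rintro rfl; exact hj (hts hi)
      simp [this]
    simp [this]
  · intro h g hg
    have h1 : g (p j) = ∑ i ∈ t, w i * h i := by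
      rw [he, Finset.map_affineCombination _ _ _ hw,
        Finset.affineCombination_eq_linear_combination _ _ _ hw]
      apply Finset.sum_congr rfl
      intro i hi
      simp [hg i (hts hi)]
    simp [h1]

/-- Generic heights with `i0` very low. -/
lemma exists_heights {V ι : Type*} [AddCommGroup V] [Module ℝ V] [Fintype ι]
    (p : ι → V) (i0 : ι) :
    ∃ h : ι → ℝ, ∀ (s : Finset ι) (j : ι), j ∉ s → p j ∈ affineSpan ℝ (p '' (s : Set ι)) →
      ∀ g : V →ᵃ[ℝ] ℝ, (∀ i ∈ s, g (p i) = h i) → g (p j) ≠ h j ∧ (j = i0 → h j < g (p j)) := by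
  let K := {k : Finset ι × ι // k.2 ∉ k.1 ∧ p k.2 ∈ affineSpan ℝ (p '' (k.1 : Set ι))}
  have hK : ∀ k : K, _ := fun k => exists_gap p k.1.1 k.1.2 k.2.1 k.2.2
  choose f hf1 hf2 using hK
  have hcont : ∀ k, Continuous (f k) := fun k => (f k).continuous_of_finiteDimensional
  let U : Set (ι → ℝ) := ⋂ k : K, {h | k.1.2 = i0 → f k h < 0}
  have hU : IsOpen U := by
    apply isOpen_iInter_of_finite
    intro k
    by_cases hk : k.1.2 = i0
    · simpa [hk] using isOpen_lt (hcont k) continuous_const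
    · simp [hk]
  have h0 : -(Pi.single i0 1 : ι → ℝ) ∈ U := by
    simp only [U, Set.mem_iInter]
    intro k hk
    rw [map_neg, ← hk, hf1]
    norm_num
  obtain ⟨h, -, hhU, hh⟩ := dense_generic (P := Set.univ) convex_univ
    (fun k : K => (LinearMap.ker (f k)).toAffineSubspace) Finset.univ
    (fun k _ => ⟨Pi.single k.1.2 1, trivial, by
      intro hmem
      have : f k (Pi.single k.1.2 1) = 0 := hmem
      rw [hf1] at this
      norm_num at this⟩) _ trivial U hU h0
  refine ⟨h, fun s j hj hp g hg => ?_⟩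
  have e := hf2 ⟨(s, j), hj, hp⟩ h g hg
  dsimp only at e
  constructor
  · intro heq
    apply hh ⟨(s, j), hj, hp⟩ (Finset.mem_univ _)
    change f _ h = 0
    rw [e]; linarith
  · intro hji
    have := Set.mem_iInter.1 hhU ⟨(s, j), hj, hp⟩ hji
    rw [e] at this
    linarith

/-- `s` indexes a cell of the regular triangulation with heights `h`. -/
def GoodCell {V ι : Type*} [AddCommGroup V] [Module ℝ V] (p : ι → V) (h : ι → ℝ)
    (s : Finset ι) : Prop :=
  AffineIndependent ℝ (fun i : s => p i) ∧ (∀ j, p j ∈ affineSpan ℝ (p '' (s : Set ι))) ∧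
    ∃ g : V →ᵃ[ℝ] ℝ, (∀ i ∈ s, g (p i) = h i) ∧ ∀ j, j ∉ s → g (p j) < h j

/-- A generic point of the polytope lies in some cell. -/
lemma exists_cell {V ι : Type} [NormedAddCommGroup V] [NormedSpace ℝ V] [Fintype ι]
    (p : ι → V) (h : ι → ℝ)
    (hh : ∀ (s : Finset ι) (j : ι), j ∉ s → p j ∈ affineSpan ℝ (p '' (s : Set ι)) →
      ∀ g : V →ᵃ[ℝ] ℝ, (∀ i ∈ s, g (p i) = h i) → g (p j) ≠ h j)
    (x : V) (hx : x ∈ convexHull ℝ (Set.range p))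
    (hgen : ∀ s : Finset ι, x ∈ affineSpan ℝ (p '' (s : Set ι)) →
      ∀ j, p j ∈ affineSpan ℝ (p '' (s : Set ι))) :
    ∃ s : Finset ι, GoodCell p h s ∧ x ∈ convexHull ℝ (p '' (s : Set ι)) := by
  let q : ι → V × ℝ := fun i => (p i, h i)
  let C : Set (V × ℝ) := convexHull ℝ (Set.range q)
  have hC : Convex ℝ C := convex_convexHull ℝ _
  have hCc : IsCompact C := (Set.finite_range q).isCompact_convexHull ℝ
  have hqC : ∀ i, q i ∈ C := fun i => subset_convexHull ℝ _ ⟨i, rfl⟩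
  -- the lowest point above `x`
  have hne : (C ∩ Prod.fst ⁻¹' {x}).Nonempty := by
    have himg : (LinearMap.fst ℝ V ℝ) '' C = convexHull ℝ (Set.range p) := by
      rw [LinearMap.image_convexHull, ← Set.range_comp]
      rfl
    rw [← himg] at hx
    obtain ⟨y, hy, hyx⟩ := hx
    exact ⟨y, hy, hyx⟩
  obtain ⟨⟨x', m⟩, ⟨hmC, hx'⟩, hmin⟩ :=
    (hCc.inter_right (isClosed_singleton.preimage continuous_fst)).exists_isMinOn hne
      continuous_snd.continuousOn
  obtain rfl : x' = x := hx'
  have hmin' : ∀ r : ℝ, (x', r) ∈ C → m ≤ r := fun r hr => hmin ⟨hr, rfl⟩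
  obtain ⟨κ, _, z, l, hzr, hzi, hl, hl1, hlx⟩ := eq_pos_convex_span_of_mem_convexHull hmC
  have hzr' : ∀ k, ∃ i, q i = z k := fun k => hzr ⟨k, rfl⟩
  choose f hf using hzr'
  have hfz : z = fun k => (p (f k), h (f k)) := funext fun k => (hf k).symm
  have hzC : ∀ k, z k ∈ C := fun k => by rw [← hf]; exact hqC _
  -- optimality
  have hopt : ∀ (v : κ → ℝ) (c : ℝ) (j : ι), 0 ≤ c → ∑ k, v k + c = 0 →
      ∑ k, v k • p (f k) + c • p j = 0 → 0 ≤ ∑ k, v k * h (f k) + c * h j := by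
    intro v c j hc hv hvp
    obtain ⟨e, he, hmem⟩ := perturb_mem hC z hzC (q j) (hqC j) l hl hl1 v c hc hv
    have h2 : ∑ k, v k • z k + c • q j = (0, ∑ k, v k * h (f k) + c * h j) := by
      ext1
      · simpa [hfz, q, Prod.fst_sum] using hvp
      · simp [hfz, q, Prod.snd_sum]
    rw [hlx, h2] at hmem
    have := hmin' (m + e * (∑ k, v k * h (f k) + c * h j)) (by simpa using hmem)
    have h3 : 0 ≤ e * (∑ k, v k * h (f k) + c * h j) := by linarith
    exact nonneg_of_mul_nonneg_right h3 he
  have hκ : Nonempty κ := by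
    by_contra hcon
    rw [not_nonempty_iff] at hcon
    simp at hl1
  obtain ⟨k0⟩ := hκ
  have hind : AffineIndependent ℝ (fun k => p (f k)) := by
    rw [affineIndependent_iff_of_fintype]
    intro w hw hwp
    rw [Finset.weightedVSub_eq_linear_combination _ hw] at hwp
    have h1 := hopt w 0 (f k0) le_rfl (by simpa using hw) (by simpa using hwp)
    have h2 := hopt (-w) 0 (f k0) le_rfl (by simpa using hw) (by simpa using hwp)
    have h3 : ∑ k, w k * h (f k) = 0 := by
      simp at h1 h2
      linarith
    apply (affineIndependent_iff_of_fintype ℝ z).1 hzi w hw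
    rw [Finset.weightedVSub_eq_linear_combination _ hw]
    ext1
    · simpa [hfz, Prod.fst_sum] using hwp
    · simpa [hfz, Prod.snd_sum] using h3
  let s : Finset ι := Finset.univ.image f
  have hps : p '' (s : Set ι) = Set.range (fun k => p (f k)) := by
    simp only [s, Finset.coe_image, Finset.coe_univ, Set.image_univ, ← Set.range_comp]
    rfl
  have hxs : x' ∈ convexHull ℝ (p '' (s : Set ι)) := by
    have hxsum : ∑ k, l k • p (f k) = x' := by
      have := congrArg Prod.fst hlx
      simpa [hfz, Prod.fst_sum] using this
    rw [hps, ← hxsum]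
    exact (convex_convexHull ℝ _).sum_mem (fun k _ => (hl k).le) hl1
      (fun k _ => subset_convexHull ℝ _ ⟨k, rfl⟩)
  have hspan := hgen s (convexHull_subset_affineSpan _ hxs)
  obtain ⟨g, hg⟩ := exists_affine_interp _ hind (fun k => h (f k))
  have hgs : ∀ i ∈ s, g (p i) = h i := by
    intro i hi
    obtain ⟨k, -, rfl⟩ := Finset.mem_image.1 hi
    exact hg k
  refine ⟨s, ⟨?_, hspan, g, hgs, ?_⟩, hxs⟩
  · have hr : AffineIndependent ℝ (fun y : Set.range (fun k => p (f k)) => (y : V)) := hind.range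
    have hinj : ∀ i ∈ s, ∀ j ∈ s, p i = p j → i = j := by
      intro i hi j hj hij
      obtain ⟨k, -, rfl⟩ := Finset.mem_image.1 hi
      obtain ⟨k', -, rfl⟩ := Finset.mem_image.1 hj
      rw [hind.injective hij]
    have hmem : ∀ i : {i // i ∈ s}, p i ∈ Set.range (fun k => p (f k)) := by
      intro i
      rw [← hps]
      exact ⟨i, i.2, rfl⟩
    let em : {i // i ∈ s} ↪ Set.range (fun k => p (f k)) := ⟨fun i => ⟨p i, hmem i⟩, by
      intro i j hij
      exact Subtype.ext (hinj i i.2 j j.2 (congrArg Subtype.val hij))⟩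
    exact hr.comp_embedding em
  · intro j hj
    refine lt_of_le_of_ne ?_ (hh s j hj (hspan j) g hgs)
    have hj' := hspan j
    rw [hps] at hj'
    obtain ⟨w, hw, he⟩ := eq_affineCombination_of_mem_affineSpan_of_fintype hj'
    have h1 : g (p j) = ∑ k, w k * h (f k) := by
      rw [he, Finset.map_affineCombination _ _ _ hw,
        Finset.affineCombination_eq_linear_combination _ _ _ hw]
      simp [hg]
    rw [Finset.affineCombination_eq_linear_combination _ _ _ hw] at he
    have := hopt (-w) 1 j zero_le_one (by simp [hw]) (by simp [← he])
    simp at this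
    linarith

/-- On a cell, the interpolating function of another cell lies below. -/
lemma affine_le_on_hull {V ι : Type*} [AddCommGroup V] [Module ℝ V] (p : ι → V)
    (h : ι → ℝ) (s : Finset ι) (g g' : V →ᵃ[ℝ] ℝ) (hg : ∀ i ∈ s, g (p i) = h i)
    (hg' : ∀ i, g' (p i) ≤ h i) (x : V) (hx : x ∈ convexHull ℝ (p '' (s : Set ι))) :
    g' x ≤ g x := by
  have hconv : Convex ℝ {y | 0 ≤ (g - g') y} :=
    (convex_Ici (0 : ℝ)).affine_preimage (g - g')
  have hsub : convexHull ℝ (p '' (s : Set ι)) ⊆ {y | 0 ≤ (g - g') y} := by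
    apply convexHull_min _ hconv
    rintro _ ⟨i, hi, rfl⟩
    have := hg' i
    simpa [hg i hi] using this
  have := hsub hx
  simpa using this

lemma GoodCell.le {V ι : Type*} [AddCommGroup V] [Module ℝ V] {p : ι → V}
    {h : ι → ℝ} {s : Finset ι} {g : V →ᵃ[ℝ] ℝ} (h1 : ∀ i ∈ s, g (p i) = h i)
    (h2 : ∀ j, j ∉ s → g (p j) < h j) (i : ι) : g (p i) ≤ h i := by
  by_cases hi : i ∈ s
  · exact (h1 i hi).le
  · exact (h2 i hi).le

/-- Cells whose interpolating functions agree everywhere are nested. -/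
lemma cell_subset {V ι : Type*} [AddCommGroup V] [Module ℝ V] {p : ι → V}
    {h : ι → ℝ} {s t : Finset ι} {g g' : V →ᵃ[ℝ] ℝ}
    (h2 : ∀ j, j ∉ s → g (p j) < h j) (h3 : ∀ i ∈ t, g' (p i) = h i)
    (he : ∀ i, g (p i) = g' (p i)) : t ⊆ s := by
  intro i hi
  by_contra hs
  have := h2 i hs
  rw [he, h3 i hi] at this
  exact lt_irrefl _ this

/-- Main construction for an indexed family of points. -/
lemma starring_of_family {N n : ℕ} {ι : Type} [Fintype ι] (p : ι → Euc N) (i0 : ι)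
    (hdim : sdim (convexHull ℝ (Set.range p)) = n) :
    ∃ F : Finset (Set (Euc N)), IsStarring n (convexHull ℝ (Set.range p)) (p i0) F := by
  obtain ⟨h, hh⟩ := exists_heights p i0
  let P := convexHull ℝ (Set.range p)
  have hpP : ∀ i, p i ∈ P := fun i => subset_convexHull ℝ _ ⟨i, rfl⟩
  have hPspan : affineSpan ℝ P = affineSpan ℝ (Set.range p) := affineSpan_convexHull _
  have hcellspan : ∀ s, GoodCell p h s →
      affineSpan ℝ (p '' (s : Set ι)) = affineSpan ℝ P := by
    intro s hs
    rw [hPspan]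
    apply le_antisymm
    · exact affineSpan_mono _ (Set.image_subset_range _ _)
    · rw [affineSpan_le]
      rintro _ ⟨j, rfl⟩
      exact hs.2.1 j
  have hi0 : ∀ s, GoodCell p h s → i0 ∈ s := by
    rintro s ⟨-, hs, g, hg, hg'⟩
    by_contra hcon
    have h1 := (hh s i0 hcon (hs i0) g hg).2 rfl
    have h2 := hg' i0 hcon
    exact lt_asymm h1 h2
  have hcard : ∀ s, GoodCell p h s → s.card = n + 1 := by
    intro s hs
    have hpos : 0 < s.card := Finset.card_pos.2 ⟨i0, hi0 s hs⟩
    obtain ⟨k, hk⟩ : ∃ k, s.card = k + 1 := ⟨s.card - 1, by omega⟩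
    have h1 := hs.1.finrank_vectorSpan (n := k) (by simpa using hk)
    have h2 : Set.range (fun i : s => p i) = p '' (s : Set ι) := by
      rw [Set.image_eq_range]; rfl
    rw [h2, ← direction_affineSpan, hcellspan s hs, direction_affineSpan] at h1
    have : k = n := by rw [← h1, ← hdim]; rfl
    omega
  have hsimp : ∀ s, GoodCell p h s → ∃ v : Fin (n + 1) → Euc N, AffineIndependent ℝ v ∧
      convexHull ℝ (p '' (s : Set ι)) = convexHull ℝ (Set.range v) ∧ p i0 ∈ Set.range v := by
    intro s hs
    let e := s.equivFinOfCardEq (hcard s hs)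
    have hr : Set.range (fun k => p (e.symm k)) = p '' (s : Set ι) := by
      ext y
      constructor
      · rintro ⟨k, rfl⟩
        exact ⟨_, (e.symm k).2, rfl⟩
      · rintro ⟨i, hi, rfl⟩
        exact ⟨e ⟨i, hi⟩, by simp⟩
    refine ⟨fun k => p (e.symm k), hs.1.comp_embedding e.symm.toEmbedding, by rw [hr], ?_⟩
    rw [hr]
    exact ⟨i0, hi0 s hs, rfl⟩
  let G : Finset (Finset ι) := Finset.univ.filter (fun s => GoodCell p h s)
  let F : Finset (Set (Euc N)) := G.image (fun s : Finset ι => convexHull ℝ (p '' (s : Set ι)))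
  have hF : ∀ T ∈ F, ∃ s, GoodCell p h s ∧ T = convexHull ℝ (p '' (s : Set ι)) := by
    intro T hT
    obtain ⟨s, hs, rfl⟩ := Finset.mem_image.1 hT
    exact ⟨s, (Finset.mem_filter.1 hs).2, rfl⟩
  have hsubP : ∀ s : Finset ι, convexHull ℝ (p '' (s : Set ι)) ⊆ P := fun s =>
    convexHull_mono (Set.image_subset_range _ _)
  refine ⟨F, ⟨?_, ?_, ?_⟩, ?_⟩
  · intro T hT
    obtain ⟨s, hs, rfl⟩ := hF T hT
    obtain ⟨v, hv, he, -⟩ := hsimp s hs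
    exact ⟨v, hv, he⟩
  · apply Set.Subset.antisymm
    · apply Set.iUnion₂_subset
      intro T hT
      obtain ⟨s, hs, rfl⟩ := hF T hT
      exact hsubP s
    · have hclosed : IsClosed (⋃ T ∈ F, T) := by
        apply Set.Finite.isClosed_biUnion F.finite_toSet
        intro T hT
        obtain ⟨s, hs, rfl⟩ := hF T hT
        exact ((s.finite_toSet.image p).isCompact_convexHull ℝ).isClosed
      intro x hx
      rw [← hclosed.closure_eq, mem_closure_iff]
      intro U hU hxU
      obtain ⟨y, hyP, hyU, hy⟩ := dense_generic (convex_convexHull ℝ (Set.range p))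
        (fun s : Finset ι => affineSpan ℝ (p '' (s : Set ι)))
        (Finset.univ.filter fun s => ¬ ∀ j, p j ∈ affineSpan ℝ (p '' (s : Set ι)))
        (by
          intro s hs
          have := (Finset.mem_filter.1 hs).2
          push Not at this
          obtain ⟨j, hj⟩ := this
          exact ⟨p j, hpP j, hj⟩) x hx U hU hxU
      obtain ⟨s, hs, hys⟩ := exists_cell p h (fun s j hj hp g hg => (hh s j hj hp g hg).1) y hyP (by
        intro s hys
        by_contra hcon
        exact hy s (Finset.mem_filter.2 ⟨Finset.mem_univ _, hcon⟩) hys)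
      refine ⟨y, hyU, Set.mem_iUnion₂.2 ⟨_, ?_, hys⟩⟩
      exact Finset.mem_image.2 ⟨s, Finset.mem_filter.2 ⟨Finset.mem_univ _, hs⟩, rfl⟩
  · intro S hS T hT hne
    obtain ⟨s, hs, rfl⟩ := hF S hS
    obtain ⟨t, ht, rfl⟩ := hF T hT
    by_contra hcon
    apply hne
    set I := convexHull ℝ (p '' (s : Set ι)) ∩ convexHull ℝ (p '' (t : Set ι)) with hI
    have hIP : I ⊆ P := Set.inter_subset_left.trans (hsubP s)
    have hvs : vectorSpan ℝ I = vectorSpan ℝ P := by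
      apply Submodule.eq_of_le_of_finrank_le (vectorSpan_mono ℝ hIP)
      change sdim P ≤ sdim I
      rw [hdim]
      exact not_lt.1 hcon
    have haI : p i0 ∈ I :=
      ⟨subset_convexHull ℝ _ ⟨i0, hi0 s hs, rfl⟩, subset_convexHull ℝ _ ⟨i0, hi0 t ht, rfl⟩⟩
    have hspanI : affineSpan ℝ I = affineSpan ℝ P := by
      apply AffineSubspace.ext_of_direction_eq
      · rw [direction_affineSpan, direction_affineSpan, hvs]
      · exact ⟨p i0, mem_affineSpan ℝ haI, mem_affineSpan ℝ (hpP i0)⟩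
    obtain ⟨-, -, g, hg1, hg2⟩ := hs
    obtain ⟨-, -, g', hg1', hg2'⟩ := ht
    have heq : Set.EqOn g g' I := by
      rintro x ⟨hxs, hxt⟩
      exact le_antisymm
        (affine_le_on_hull p h t g' g hg1' (GoodCell.le hg1 hg2) x hxt)
        (affine_le_on_hull p h s g g' hg1 (GoodCell.le hg1' hg2') x hxs)
    have hall : ∀ i, g (p i) = g' (p i) := by
      intro i
      have hmem : p i ∈ affineSpan ℝ I := by rw [hspanI]; exact mem_affineSpan ℝ (hpP i)
      have hle : affineSpan ℝ I ≤ (AffineSubspace.mk' (0 : ℝ) ⊥).comap (g - g') := by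
        rw [affineSpan_le]
        intro x hx
        have := heq hx
        simp [AffineSubspace.mem_mk', this]
      have := hle hmem
      simp only [AffineSubspace.mem_comap, AffineSubspace.mem_mk'] at this
      simpa [sub_eq_zero] using this
    have : s = t := Finset.Subset.antisymm (cell_subset hg2' hg1 fun i => (hall i).symm)
      (cell_subset hg2 hg1' hall)
    rw [this]
  · intro T hT
    obtain ⟨s, hs, rfl⟩ := hF T hT
    exact hsimp s hs

/-- every `n`-dimensional polytope admits a starring at each of its points. -/
theorem polytope_has_starring {N n : ℕ} (P : Set (Euc N)) (hP : IsPolytope P)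
    (hdim : sdim P = n) (a : Euc N) (ha : a ∈ P) :
    ∃ F : Finset (Set (Euc N)), IsStarring n P a F := by
  obtain ⟨t, -, rfl⟩ := hP
  let p : {x // x ∈ insert a t} → Euc N := Subtype.val
  have hr : convexHull ℝ (Set.range p) = convexHull ℝ (t : Set (Euc N)) := by
    have h1 : Set.range p = insert a (t : Set (Euc N)) := by
      ext y
      simp [p]
    rw [h1]
    apply Set.Subset.antisymm
    · apply convexHull_min _ (convex_convexHull ℝ _)
      exact Set.insert_subset ha (subset_convexHull ℝ _)
    · exact convexHull_mono (Set.subset_insert _ _)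
  rw [← hr] at hdim ⊢
  exact starring_of_family p ⟨a, Finset.mem_insert_self _ _⟩ hdim
end
end

section
/- If αT is a starring of an n-simplex T (a triangulation of T in which every n-simplex has a vertex at a fixed point a ∈ T), then αT is equivalent by finitely many elementary moves to the trivial triangulation {T}. -/
open Set MeasureTheory
open scoped Classical
noncomputable section

namespace Star
set_option linter.unusedSectionVars false

section P1
variable {V : Type*} [NormedAddCommGroup V] [NormedSpace ℝ V]

/-- generic points: off finitely many hyperplanes -/
def gen (V : Type*) [NormedAddCommGroup V] [NormedSpace ℝ V] : Filter V :=
  ⨅ f : {f : V →ᵃ[ℝ] ℝ // f ≠ 0}, Filter.principal {x | f.1 x ≠ 0}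

lemma gen_ne (f : V →ᵃ[ℝ] ℝ) (hf : f ≠ 0) : ∀ᶠ x in gen V, f x ≠ 0 :=
  Filter.mem_iInf_of_mem ⟨f, hf⟩ (Filter.mem_principal_self _)

lemma dense_ne (f : V →ᵃ[ℝ] ℝ) (hf : f ≠ 0) : Dense {x | f x ≠ 0} := by
  intro x
  by_cases hx : f x = 0
  · have : ∃ v, f.linear v ≠ 0 := by
      by_contra! h
      apply hf
      ext y
      have := f.map_vadd x (y - x)
      simp [h, hx] at this
      simpa using this
    obtain ⟨v, hv⟩ := this
    have ht : Filter.Tendsto (fun t : ℝ => x + t • v) (nhdsWithin 0 {0}ᶜ) (nhds x) := by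
      have : Continuous (fun t : ℝ => x + t • v) := by fun_prop
      have h2 := this.tendsto 0
      simp only [zero_smul, add_zero] at h2
      exact h2.mono_left nhdsWithin_le_nhds
    refine mem_closure_of_tendsto ht ?_
    filter_upwards [self_mem_nhdsWithin] with t ht0
    have := f.map_vadd x (t • v)
    simp only [vadd_eq_add, hx, add_zero, map_smul, smul_eq_mul] at this
    show f (x + t • v) ≠ 0
    rw [add_comm, this]
    exact mul_ne_zero ht0 hv
  · exact subset_closure hx

lemma gen_dense [FiniteDimensional ℝ V] {p : V → Prop} (h : ∀ᶠ x in gen V, p x) :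
    Dense {x | p x} := by
  have : CompleteSpace V := FiniteDimensional.complete ℝ V
  have hle : residual V ≤ gen V := by
    refine le_iInf fun f => Filter.le_principal_iff.2 ?_
    apply residual_of_dense_open
    · have : Continuous f.1 := f.1.continuous_of_finiteDimensional
      exact isOpen_ne_fun this continuous_const
    · exact dense_ne f.1 f.2
  exact dense_of_mem_residual (hle h)

lemma exists_vanish (S : Set V) (hS : affineSpan ℝ S ≠ ⊤) :
    ∃ f : V →ᵃ[ℝ] ℝ, f ≠ 0 ∧ ∀ x ∈ S, f x = 0 := by
  rcases S.eq_empty_or_nonempty with rfl | ⟨p, hp⟩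
  · refine ⟨AffineMap.const ℝ V 1, ?_, by simp⟩
    intro h
    have := congrArg (fun g => g 0) h
    simp at this
  · have hd : vectorSpan ℝ S < ⊤ := by
      rw [lt_top_iff_ne_top]
      intro h
      apply hS
      rw [AffineSubspace.affineSpan_eq_top_iff_vectorSpan_eq_top_of_nonempty (k := ℝ) (V := V) (P := V) (hs := ⟨p, hp⟩)]
      exact h
    obtain ⟨g, hg, hle⟩ := Submodule.exists_le_ker_of_lt_top _ hd
    refine ⟨g.toAffineMap - AffineMap.const ℝ V (g p), ?_, ?_⟩
    · intro h
      apply hg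
      have := congrArg AffineMap.linear h
      ext x
      have := congrArg (fun k => k x) this
      simpa using this
    · intro x hx
      have : x - p ∈ vectorSpan ℝ S := vsub_mem_vectorSpan ℝ hx hp
      have := hle this
      simp only [LinearMap.mem_ker, map_sub] at this
      simpa using this

lemma gen_notMem (S : Set V) (hS : affineSpan ℝ S ≠ ⊤) : ∀ᶠ x in gen V, x ∉ S := by
  obtain ⟨f, hf, h⟩ := exists_vanish S hS
  filter_upwards [gen_ne f hf] with x hx hxS
  exact hx (h x hxS)

/-- vertex set -/
def vs (M : Multiset V) : Set V := {x | x ∈ M}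

/-- convex hull of a multiset of vertices -/
def hull (M : Multiset V) : Set V := convexHull ℝ (vs M)

/-- nondegenerate simplex -/
def Nondeg (M : Multiset V) : Prop :=
  Multiset.card M = Module.finrank ℝ V + 1 ∧ affineSpan ℝ (vs M) = ⊤

@[simp] lemma vs_cons (x : V) (M : Multiset V) : vs (x ::ₘ M) = insert x (vs M) := by
  ext y; simp [vs]

lemma vs_finite (M : Multiset V) : (vs M).Finite := by
  have : vs M = (M.toFinset : Set V) := by ext; simp [vs]
  rw [this]; exact Finset.finite_toSet _

lemma span_ne_top_of_card [FiniteDimensional ℝ V] (M : Multiset V)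
    (h : Multiset.card M ≤ Module.finrank ℝ V) : affineSpan ℝ (vs M) ≠ ⊤ := by
  intro ht
  have hv : vs M = (M.toFinset : Set V) := by ext; simp [vs]
  have hne : (vs M).Nonempty := by
    by_contra hn
    rw [Set.not_nonempty_iff_eq_empty] at hn
    rw [hn] at ht
    simp at ht
  have h1 : vectorSpan ℝ (vs M) = ⊤ :=
    (AffineSubspace.affineSpan_eq_top_iff_vectorSpan_eq_top_of_nonempty (k := ℝ) (V := V) (P := V) (hs := hne)).1 ht
  have hc : 1 ≤ M.toFinset.card := by
    rw [hv] at hne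
    exact Finset.card_pos.2 (by exact_mod_cast hne)
  have h2 := finrank_vectorSpan_image_finset_le ℝ (id : V → V) M.toFinset
    (n := M.toFinset.card - 1) (by omega)
  rw [Finset.image_id, ← hv, h1, finrank_top] at h2
  have := Multiset.toFinset_card_le M
  omega

lemma span_hull (M : Multiset V) : affineSpan ℝ (hull M) = affineSpan ℝ (vs M) :=
  affineSpan_convexHull _

lemma gen_notMem_hull [FiniteDimensional ℝ V] (M : Multiset V) (h : affineSpan ℝ (vs M) ≠ ⊤) :
    ∀ᶠ x in gen V, x ∉ hull M := gen_notMem _ (by rwa [span_hull])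

lemma not_nondeg_dup [FiniteDimensional ℝ V] (x : V) (R : Multiset V) :
    ¬ Nondeg (x ::ₘ x ::ₘ R) := by
  rintro ⟨h1, h2⟩
  simp only [vs_cons, insert_eq_of_mem, mem_insert_iff, true_or] at h2
  rw [← vs_cons] at h2
  refine span_ne_top_of_card _ ?_ h2
  simp at h1 ⊢
  omega

lemma hull_mono {M M' : Multiset V} (h : vs M ⊆ hull M') : hull M ⊆ hull M' :=
  convexHull_min h (convex_convexHull _ _)

lemma vs_subset_hull (M : Multiset V) : vs M ⊆ hull M := subset_convexHull _ _

lemma mem_hull {M : Multiset V} {x : V} (h : x ∈ M) : x ∈ hull M := vs_subset_hull M h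

lemma seg_mem_hull {x y m : V} (R : Multiset V) (hm : m ∈ segment ℝ x y) :
    m ∈ hull (x ::ₘ y ::ₘ R) :=
  (convex_convexHull ℝ _).segment_subset (mem_hull (by simp)) (mem_hull (by simp)) hm

lemma hull_cut_left {x y m : V} (R : Multiset V) (hm : m ∈ segment ℝ x y) :
    hull (x ::ₘ m ::ₘ R) ⊆ hull (x ::ₘ y ::ₘ R) := by
  apply hull_mono
  intro z hz
  simp only [vs_cons, mem_insert_iff] at hz
  rcases hz with rfl | rfl | hz
  · exact mem_hull (by simp)
  · exact seg_mem_hull R hm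
  · exact mem_hull (by simp [show z ∈ R from hz])

lemma hull_cut_right {x y m : V} (R : Multiset V) (hm : m ∈ segment ℝ x y) :
    hull (m ::ₘ y ::ₘ R) ⊆ hull (x ::ₘ y ::ₘ R) := by
  apply hull_mono
  intro z hz
  simp only [vs_cons, mem_insert_iff] at hz
  rcases hz with rfl | rfl | hz
  · exact seg_mem_hull R hm
  · exact mem_hull (by simp)
  · exact mem_hull (by simp [show z ∈ R from hz])

lemma hull_pair (x y : V) (R : Multiset V) (hR : (vs R).Nonempty) :
    hull (x ::ₘ y ::ₘ R) = convexJoin ℝ (segment ℝ x y) (hull R) := by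
  have : vs (x ::ₘ y ::ₘ R) = {x, y} ∪ vs R := by
    simp [Set.insert_union]
  rw [hull, this, convexHull_union (by simp) hR, convexHull_pair]
  rfl

lemma segment_split {x y m : V} (hm : m ∈ segment ℝ x y) :
    segment ℝ x y ⊆ segment ℝ x m ∪ segment ℝ m y := by
  rw [segment_eq_image_lineMap] at hm
  obtain ⟨c, hc, rfl⟩ := hm
  intro z hz
  rw [segment_eq_image_lineMap] at hz
  obtain ⟨d, hd, rfl⟩ := hz
  have key : ∀ p q : ℝ, p ∈ segment ℝ q d → True := fun _ _ _ => trivial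
  rcases le_total d c with h | h
  · left
    have : d ∈ segment ℝ (0:ℝ) c := by rw [segment_eq_Icc hc.1]; exact ⟨hd.1, h⟩
    have := mem_image_of_mem (AffineMap.lineMap x y : ℝ →ᵃ[ℝ] V) this
    rwa [image_segment, AffineMap.lineMap_apply_zero] at this
  · right
    have : d ∈ segment ℝ c (1:ℝ) := by rw [segment_eq_Icc hc.2]; exact ⟨h, hd.2⟩
    have := mem_image_of_mem (AffineMap.lineMap x y : ℝ →ᵃ[ℝ] V) this
    rwa [image_segment, AffineMap.lineMap_apply_one] at this

lemma hull_cut {x y m : V} (R : Multiset V) (hm : m ∈ segment ℝ x y) :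
    hull (x ::ₘ y ::ₘ R) = hull (x ::ₘ m ::ₘ R) ∪ hull (m ::ₘ y ::ₘ R) := by
  apply subset_antisymm
  · rcases (vs R).eq_empty_or_nonempty with h | h
    · simp only [hull, vs_cons, h, insert_empty_eq, convexHull_pair]
      exact segment_split hm
    · rw [hull_pair _ _ _ h, hull_pair _ _ _ h, hull_pair _ _ _ h, ← convexJoin_union_left]
      exact convexJoin_mono_left (segment_split hm)
  · exact union_subset (hull_cut_left R hm) (hull_cut_right R hm)

lemma affine_seg (f : V →ᵃ[ℝ] ℝ) {x y m : V} (hm : m ∈ segment ℝ x y) :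
    ∃ a b : ℝ, 0 ≤ a ∧ 0 ≤ b ∧ a + b = 1 ∧ a • x + b • y = m ∧ f m = a * f x + b * f y := by
  obtain ⟨a, b, ha, hb, hab, rfl⟩ := hm
  refine ⟨a, b, ha, hb, hab, rfl, ?_⟩
  have := Convex.combo_affine_apply (f := f) (x := x) (y := y) hab
  simpa using this

lemma hull_nonneg (f : V →ᵃ[ℝ] ℝ) (M : Multiset V) (h : ∀ x ∈ M, 0 ≤ f x) :
    ∀ x ∈ hull M, 0 ≤ f x := by
  have : hull M ⊆ f ⁻¹' (Ici 0) :=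
    convexHull_min h ((convex_Ici 0).affine_preimage f)
  exact this

lemma hull_nonpos (f : V →ᵃ[ℝ] ℝ) (M : Multiset V) (h : ∀ x ∈ M, f x ≤ 0) :
    ∀ x ∈ hull M, f x ≤ 0 := by
  have : hull M ⊆ f ⁻¹' (Iic 0) :=
    convexHull_min h ((convex_Iic 0).affine_preimage f)
  exact this

/-- the separating function for a cut -/
lemma exists_sep [FiniteDimensional ℝ V] {x y m : V} (R : Multiset V)
    (hc : Multiset.card (x ::ₘ y ::ₘ R) ≤ Module.finrank ℝ V + 1)
    (hm : m ∈ segment ℝ x y) (hx : m ≠ x) (hy : m ≠ y) :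
    ∃ f : V →ᵃ[ℝ] ℝ, f ≠ 0 ∧ f m = 0 ∧ (∀ r ∈ R, f r = 0) ∧ f x ≤ 0 ∧ 0 ≤ f y := by
  have hs : affineSpan ℝ (vs (m ::ₘ R)) ≠ ⊤ := span_ne_top_of_card _ (by simp at hc ⊢; omega)
  obtain ⟨f, hf, h⟩ := exists_vanish _ hs
  have hfm : f m = 0 := h m (by simp)
  have hfR : ∀ r ∈ R, f r = 0 := fun r hr => h r (by simp [show r ∈ vs R from hr])
  obtain ⟨a, b, ha, hb, hab, he, hh⟩ := affine_seg f hm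
  have ha' : 0 < a := by
    rcases ha.eq_or_lt with h | h
    · exfalso; subst h; simp at hab; subst hab; simp at he; exact hy he.symm
    · exact h
  have hb' : 0 < b := by
    rcases hb.eq_or_lt with h | h
    · exfalso; subst h; simp at hab; subst hab; simp at he; exact hx he.symm
    · exact h
  rw [hfm] at hh
  rcases le_total (f x) 0 with h1 | h1
  · refine ⟨f, hf, hfm, hfR, h1, ?_⟩
    by_contra! h2
    nlinarith [mul_pos hb' (neg_pos.2 h2), mul_nonneg ha (neg_nonneg.2 h1)]
  · refine ⟨-f, neg_ne_zero.2 hf, by simp [hfm], fun r hr => by simp [hfR r hr], by simpa using h1, ?_⟩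
    by_contra! h2
    simp at h2
    nlinarith [mul_pos hb' h2, mul_nonneg ha h1]

/-- counting function -/
def cnt (F : Multiset (Multiset V)) (x : V) : ℕ :=
  (F.map (fun M => if x ∈ hull M then 1 else 0)).sum

@[simp] lemma cnt_zero (x : V) : cnt 0 x = 0 := rfl
@[simp] lemma cnt_cons (M : Multiset V) (F : Multiset (Multiset V)) (x : V) :
    cnt (M ::ₘ F) x = (if x ∈ hull M then 1 else 0) + cnt F x := by simp [cnt]
@[simp] lemma cnt_add (F G : Multiset (Multiset V)) (x : V) :
    cnt (F + G) x = cnt F x + cnt G x := by simp [cnt]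

lemma cnt_cut [FiniteDimensional ℝ V] {x y m : V} (R : Multiset V)
    (hc : Multiset.card (x ::ₘ y ::ₘ R) = Module.finrank ℝ V + 1)
    (hm : m ∈ segment ℝ x y) :
    ∀ᶠ z in gen V, (if z ∈ hull (x ::ₘ y ::ₘ R) then 1 else 0 : ℕ) =
      (if z ∈ hull (x ::ₘ m ::ₘ R) then 1 else 0) + (if z ∈ hull (m ::ₘ y ::ₘ R) then 1 else 0) := by
  have hdup : ∀ w : V, ∀ᶠ z in gen V, z ∉ hull (w ::ₘ w ::ₘ R) := by
    intro w
    apply gen_notMem_hull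
    intro h
    exact not_nondeg_dup w R ⟨by simpa using hc, h⟩
  by_cases hx : m = x
  · subst hx
    filter_upwards [hdup m] with z hz
    simp [hz]
  by_cases hy : m = y
  · subst hy
    filter_upwards [hdup m] with z hz
    simp [hz]
  obtain ⟨f, hf, hfm, hfR, hfx, hfy⟩ := exists_sep R hc.le hm hx hy
  filter_upwards [gen_ne f hf] with z hz
  rw [hull_cut R hm]
  have h1 : z ∈ hull (x ::ₘ m ::ₘ R) → f z ≤ 0 := by
    apply hull_nonpos
    simp only [Multiset.mem_cons]
    rintro w (rfl | rfl | hw)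
    · exact hfx
    · exact hfm.le
    · exact (hfR w hw).le
  have h2 : z ∈ hull (m ::ₘ y ::ₘ R) → 0 ≤ f z := by
    apply hull_nonneg
    simp only [Multiset.mem_cons]
    rintro w (rfl | rfl | hw)
    · exact hfm.ge
    · exact hfy
    · exact (hfR w hw).ge
  by_cases k1 : z ∈ hull (x ::ₘ m ::ₘ R) <;> by_cases k2 : z ∈ hull (m ::ₘ y ::ₘ R) <;>
    simp [k1, k2]
  exact hz (le_antisymm (h1 k1) (h2 k2))

lemma nondeg_cut_left {x y m : V} {R : Multiset V} (h : Nondeg (x ::ₘ y ::ₘ R))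
    (hm : m ∈ segment ℝ x y) (hx : m ≠ x) : Nondeg (x ::ₘ m ::ₘ R) := by
  refine ⟨by simpa using h.1, ?_⟩
  rw [eq_top_iff, ← h.2, affineSpan_le]
  intro z hz
  simp only [vs_cons, mem_insert_iff] at hz
  rcases hz with rfl | rfl | hz
  · exact subset_affineSpan _ _ (by simp)
  · obtain ⟨c, hc, rfl⟩ := by rw [segment_eq_image_lineMap] at hm; exact hm
    have hc0 : c ≠ 0 := by rintro rfl; simp at hx
    have : z = AffineMap.lineMap x (AffineMap.lineMap x z c) c⁻¹ := by
      rw [AffineMap.lineMap_lineMap_right, inv_mul_cancel₀ hc0]; simp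
    have h1 : x ∈ affineSpan ℝ (vs (x ::ₘ AffineMap.lineMap x z c ::ₘ R)) :=
      subset_affineSpan _ _ (by simp)
    have h2 : AffineMap.lineMap x z c ∈ affineSpan ℝ (vs (x ::ₘ AffineMap.lineMap x z c ::ₘ R)) :=
      subset_affineSpan _ _ (by simp)
    have key := AffineMap.lineMap_mem c⁻¹ h1 h2
    rwa [← this] at key
  · exact subset_affineSpan _ _ (by simp [hz])

lemma nondeg_cut_right {x y m : V} {R : Multiset V} (h : Nondeg (x ::ₘ y ::ₘ R))
    (hm : m ∈ segment ℝ x y) (hy : m ≠ y) : Nondeg (m ::ₘ y ::ₘ R) := by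
  rw [Multiset.cons_swap] at h ⊢
  exact nondeg_cut_left h (by rwa [segment_symm]) hy

lemma span_cut_le {x y m : V} {R : Multiset V} (hm : m ∈ segment ℝ x y) :
    affineSpan ℝ (vs (x ::ₘ m ::ₘ R)) ≤ affineSpan ℝ (vs (x ::ₘ y ::ₘ R)) := by
  rw [← span_hull, ← span_hull]
  exact affineSpan_mono _ (hull_cut_left R hm)

lemma nondeg_of_cut_left {x y m : V} {R : Multiset V} (h : Nondeg (x ::ₘ m ::ₘ R))
    (hm : m ∈ segment ℝ x y) : Nondeg (x ::ₘ y ::ₘ R) := by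
  refine ⟨by simpa using h.1, ?_⟩
  rw [eq_top_iff, ← h.2]
  exact span_cut_le hm

lemma nondeg_of_cut_right {x y m : V} {R : Multiset V} (h : Nondeg (m ::ₘ y ::ₘ R))
    (hm : m ∈ segment ℝ x y) : Nondeg (x ::ₘ y ::ₘ R) := by
  rw [Multiset.cons_swap] at h ⊢
  exact nondeg_of_cut_left h (by rwa [segment_symm])

/-- additive functions on simplices -/
structure IsAdd {A : Type} [AddCommMonoid A] (Φ : Multiset V → A) : Prop where
  deg : ∀ M, ¬ Nondeg M → Φ M = 0
  cut : ∀ x y m R, m ∈ segment ℝ x y →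
    Φ (x ::ₘ y ::ₘ R) = Φ (x ::ₘ m ::ₘ R) + Φ (m ::ₘ y ::ₘ R)

/-- the main assertion for a space -/
def MainQ (V : Type*) [NormedAddCommGroup V] [NormedSpace ℝ V] : Prop :=
  ∀ (A : Type) [AddCommMonoid A] (Φ : Multiset V → A), IsAdd Φ →
    ∀ F G : Multiset (Multiset V), (∀ M ∈ F, Nondeg M) → (∀ M ∈ G, Nondeg M) →
      (∀ᶠ x in gen V, cnt F x = cnt G x) → (F.map Φ).sum = (G.map Φ).sum

/-- semantic subdivision -/
structure Sub (M : Multiset V) (F : Multiset (Multiset V)) : Prop where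
  add : ∀ (A : Type) [AddCommMonoid A] (Φ : Multiset V → A), IsAdd Φ → Φ M = (F.map Φ).sum
  count : ∀ᶠ x in gen V, (if x ∈ hull M then 1 else 0) = cnt F x
  sub : ∀ G ∈ F, hull G ⊆ hull M

lemma Sub.refl (M : Multiset V) : Sub M {M} :=
  ⟨fun A _ Φ h => by simp, by simp [cnt], by simp⟩

lemma Sub.deg [FiniteDimensional ℝ V] {M : Multiset V} (h : ¬ Nondeg M) (hc : Multiset.card M = Module.finrank ℝ V + 1) :
    Sub M 0 := by
  refine ⟨fun A _ Φ hΦ => by simp [hΦ.deg M h], ?_, by simp⟩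
  filter_upwards [gen_notMem_hull M (fun h' => h ⟨hc, h'⟩)] with x hx
  simp [hx]

lemma Sub.cut [FiniteDimensional ℝ V] {x y m : V} {R : Multiset V}
    (hc : Multiset.card (x ::ₘ y ::ₘ R) = Module.finrank ℝ V + 1)
    (hm : m ∈ segment ℝ x y) {F G : Multiset (Multiset V)}
    (h1 : Sub (x ::ₘ m ::ₘ R) F) (h2 : Sub (m ::ₘ y ::ₘ R) G) : Sub (x ::ₘ y ::ₘ R) (F + G) := by
  refine ⟨?_, ?_, ?_⟩
  · intro A _ Φ hΦ
    rw [hΦ.cut x y m R hm, h1.add A Φ hΦ, h2.add A Φ hΦ]; simp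
  · filter_upwards [cnt_cut R hc hm, h1.count, h2.count] with z a b c
    rw [a, b, c]; simp
  · intro K hK
    rcases Multiset.mem_add.1 hK with h | h
    · exact (h1.sub K h).trans (hull_cut_left R hm)
    · exact (h2.sub K h).trans (hull_cut_right R hm)

/-- composing subdivisions with a property -/
lemma Sub.bind {M : Multiset V} {F : Multiset (Multiset V)} (h : Sub M F)
    (P : Multiset V → Prop)
    (hF : ∀ G ∈ F, ∃ K, Sub G K ∧ ∀ k ∈ K, P k) : ∃ K, Sub M K ∧ ∀ k ∈ K, P k := by
  have : ∀ F : Multiset (Multiset V), (∀ G ∈ F, ∃ K, Sub G K ∧ ∀ k ∈ K, P k) →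
      ∃ K : Multiset (Multiset V), (∀ k ∈ K, P k) ∧
        (∀ (A : Type) [AddCommMonoid A] (Φ : Multiset V → A), IsAdd Φ →
          (F.map Φ).sum = (K.map Φ).sum) ∧ (∀ᶠ x in gen V, cnt F x = cnt K x) ∧
        ∀ k ∈ K, ∃ G ∈ F, hull k ⊆ hull G := by
    intro F
    induction F using Multiset.induction_on with
    | empty => intro _; exact ⟨0, by simp, fun A _ Φ h => by simp, by simp, by simp⟩
    | cons G F ih =>
      intro hF
      obtain ⟨K1, a1, b1⟩ := hF G (by simp)
      obtain ⟨K2, a2, b2, c2, d2⟩ := ih (fun G' h' => hF G' (by simp [h']))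
      refine ⟨K1 + K2, ?_, ?_, ?_, ?_⟩
      · intro k hk
        rcases Multiset.mem_add.1 hk with h | h
        · exact b1 k h
        · exact a2 k h
      · intro A _ Φ hΦ
        simp [b2 A Φ hΦ, a1.add A Φ hΦ]
      · filter_upwards [c2, a1.count] with x hx hy
        simp [hx, hy]
      · intro k hk
        rcases Multiset.mem_add.1 hk with h | h
        · exact ⟨G, by simp, a1.sub k h⟩
        · obtain ⟨G', h', h''⟩ := d2 k h
          exact ⟨G', by simp [h'], h''⟩
  obtain ⟨K, a, b, c, d⟩ := this F hF
  refine ⟨K, ⟨fun A _ Φ hΦ => by rw [h.add A Φ hΦ, b A Φ hΦ], ?_, ?_⟩, a⟩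
  · filter_upwards [h.count, c] with x hx hy
    rw [hx, hy]
  · intro k hk
    obtain ⟨G, h1, h2⟩ := d k hk
    exact h2.trans (h.sub G h1)

end P1
end Star

namespace Star
set_option linter.unusedSectionVars false

section P2
variable {V : Type*} [NormedAddCommGroup V] [NormedSpace ℝ V] [FiniteDimensional ℝ V]

lemma mem_map_univ {ι β : Type*} [Fintype ι] (p : ι → β) (x : β) :
    x ∈ (Finset.univ : Finset ι).val.map p ↔ ∃ i, p i = x := by
  simp only [Multiset.mem_map, Finset.mem_val, Finset.mem_univ, true_and]

lemma nondeg_basis {M : Multiset V} (h : Nondeg M) :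
    ∃ b : AffineBasis (Fin (Module.finrank ℝ V + 1)) ℝ V, M = Finset.univ.val.map b := by
  have hl : M.toList.length = Module.finrank ℝ V + 1 := by rw [Multiset.length_toList, h.1]
  let p : Fin (Module.finrank ℝ V + 1) → V := fun i => M.toList.get (i.cast hl.symm)
  have hM : M = Finset.univ.val.map p := by
    have : List.ofFn p = M.toList := by
      apply List.ext_get
      · simp [hl]
      · intro n h1 h2
        simp only [List.get_eq_getElem, List.getElem_ofFn, p, Fin.val_cast]
    rw [Fin.univ_val_map, this, Multiset.coe_toList]
  have hr : vs M = range p := by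
    ext x
    show x ∈ M ↔ _
    rw [hM]
    exact mem_map_univ p x
  have hspan : affineSpan ℝ (range p) = ⊤ := by rw [← hr]; exact h.2
  have hind : AffineIndependent ℝ p := by
    rw [affineIndependent_iff_finrank_vectorSpan_eq ℝ p (n := Module.finrank ℝ V) (by simp)]
    rw [AffineSubspace.vectorSpan_eq_top_of_affineSpan_eq_top ℝ V V hspan, finrank_top]
  exact ⟨⟨p, hind, hspan⟩, hM⟩

lemma basis_nondeg (b : AffineBasis (Fin (Module.finrank ℝ V + 1)) ℝ V) :
    Nondeg (Finset.univ.val.map b) := by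
  refine ⟨by simp, ?_⟩
  have : vs (Finset.univ.val.map b) = range b := by
    ext x; exact mem_map_univ b x
  rw [this]
  exact b.tot

lemma vs_basis (b : AffineBasis (Fin (Module.finrank ℝ V + 1)) ℝ V) :
    vs (Finset.univ.val.map b) = range b := by
  ext x; exact mem_map_univ b x

lemma affine_coord (b : AffineBasis (Fin (Module.finrank ℝ V + 1)) ℝ V) (f : V →ᵃ[ℝ] ℝ) (x : V) :
    f x = ∑ i, b.coord i x * f (b i) := by
  have h := b.affineCombination_coord_eq_self x
  conv_lhs => rw [← h]
  rw [Finset.map_affineCombination _ _ _ (b.sum_coord_apply_eq_one x),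
    Finset.affineCombination_eq_linear_combination _ _ _ (b.sum_coord_apply_eq_one x)]
  simp

/-- a nondegenerate simplex is cut out by finitely many halfspaces -/
lemma nondeg_halfspaces {M : Multiset V} (h : Nondeg M) :
    ∃ fs : Finset (V →ᵃ[ℝ] ℝ), (∀ f ∈ fs, f ≠ 0) ∧ ∀ x, x ∈ hull M ↔ ∀ f ∈ fs, 0 ≤ f x := by
  obtain ⟨b, rfl⟩ := nondeg_basis h
  refine ⟨Finset.univ.image (fun i => b.coord i), ?_, ?_⟩
  · intro f hf
    simp only [Finset.mem_image, Finset.mem_univ, true_and] at hf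
    obtain ⟨i, rfl⟩ := hf
    intro h0
    have := b.coord_apply_eq i
    rw [h0] at this
    simp at this
  · intro x
    rw [hull, vs_basis, b.convexHull_eq_nonneg_coord]
    simp

lemma nondeg_interp {M : Multiset V} (h : Nondeg M) (g : V → ℝ) :
    ∃ f : V →ᵃ[ℝ] ℝ, ∀ x ∈ M, f x = g x := by
  obtain ⟨b, rfl⟩ := nondeg_basis h
  refine ⟨∑ i, g (b i) • b.coord i, ?_⟩
  intro x hx
  obtain ⟨i, rfl⟩ := (mem_map_univ b x).1 hx
  have : ∀ (s : Finset (Fin (Module.finrank ℝ V + 1))) (y : V),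
      (∑ i ∈ s, g (b i) • b.coord i) y = ∑ i ∈ s, g (b i) * b.coord i y := by
    intro s y
    induction s using Finset.induction_on with
    | empty => simp
    | insert a s ha ih => rw [Finset.sum_insert ha, Finset.sum_insert ha, ← ih]; simp
  rw [this]
  simp [AffineBasis.coord_apply]

lemma nondeg_ext {M : Multiset V} (h : Nondeg M) (f g : V →ᵃ[ℝ] ℝ) (hfg : ∀ x ∈ M, f x = g x) :
    f = g := by
  obtain ⟨b, rfl⟩ := nondeg_basis h
  ext x
  rw [affine_coord b f, affine_coord b g]
  refine Finset.sum_congr rfl fun i _ => ?_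
  rw [hfg (b i) ((mem_map_univ b _).2 ⟨i, rfl⟩)]

lemma nondeg_center {M : Multiset V} (h : Nondeg M) :
    ∃ p ∈ hull M, ∀ f : V →ᵃ[ℝ] ℝ, (∀ x ∈ M, 0 ≤ f x) → f p = 0 → f = 0 := by
  obtain ⟨b, rfl⟩ := nondeg_basis h
  let w : Fin (Module.finrank ℝ V + 1) → ℝ := fun _ => ((Module.finrank ℝ V : ℝ) + 1)⁻¹
  have hd : (0:ℝ) < (Module.finrank ℝ V : ℝ) + 1 := by positivity
  have hw : ∑ i, w i = 1 := by simp [w]; field_simp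
  have hc : ∀ i, b.coord i (Finset.univ.affineCombination ℝ b w) = ((Module.finrank ℝ V : ℝ) + 1)⁻¹ := fun i =>
    b.coord_apply_combination_of_mem (Finset.mem_univ i) hw
  refine ⟨Finset.univ.affineCombination ℝ b w, ?_, ?_⟩
  · rw [hull, vs_basis, b.convexHull_eq_nonneg_coord]
    intro i
    rw [hc]; positivity
  · intro f hf h0
    rw [affine_coord b f] at h0
    simp only [hc] at h0
    rw [Finset.sum_eq_zero_iff_of_nonneg
      (fun i _ => mul_nonneg (by positivity) (hf _ ((mem_map_univ b _).2 ⟨i, rfl⟩)))] at h0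
    apply nondeg_ext h
    intro x hx
    obtain ⟨i, rfl⟩ := (mem_map_univ b x).1 hx
    have := h0 i (Finset.mem_univ i)
    have hne : ((Module.finrank ℝ V : ℝ)+1)⁻¹ ≠ 0 := by positivity
    simpa using (mul_eq_zero.1 this).resolve_left hne

lemma Sub.filter {M : Multiset V} {F : Multiset (Multiset V)} (h : Sub M F)
    (hc : ∀ G ∈ F, Multiset.card G = Module.finrank ℝ V + 1) :
    Sub M (F.filter Nondeg) := by
  have key : ∀ F : Multiset (Multiset V), (∀ G ∈ F, Multiset.card G = Module.finrank ℝ V + 1) →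
     (∀ (A : Type) [AddCommMonoid A] (Φ : Multiset V → A), IsAdd Φ →
      (F.map Φ).sum = ((F.filter Nondeg).map Φ).sum) ∧
      ∀ᶠ x in gen V, cnt F x = cnt (F.filter Nondeg) x := by
    intro F
    induction F using Multiset.induction_on with
    | empty => intro _; exact ⟨fun A _ Φ _ => by simp, by simp⟩
    | cons G F ih =>
      intro hF
      obtain ⟨i1, i2⟩ := ih (fun G' h' => hF G' (by simp [h']))
      by_cases hG : Nondeg G
      · rw [Multiset.filter_cons_of_pos _ hG]
        refine ⟨fun A _ Φ hΦ => by simp [i1 A Φ hΦ], ?_⟩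
        filter_upwards [i2] with x hx
        simp [hx]
      · rw [Multiset.filter_cons_of_neg _ hG]
        refine ⟨fun A _ Φ hΦ => by simp [i1 A Φ hΦ, hΦ.deg G hG], ?_⟩
        filter_upwards [i2, gen_notMem_hull G (fun h' => hG ⟨hF G (by simp), h'⟩)] with x hx hx2
        simp [hx, hx2]
  obtain ⟨k1, k2⟩ := key F hc
  refine ⟨fun A _ Φ hΦ => by rw [h.add A Φ hΦ, k1 A Φ hΦ], ?_, ?_⟩
  · filter_upwards [h.count, k2] with x h1 h2
    rw [h1, h2]
  · intro G hG
    exact h.sub G (Multiset.mem_of_mem_filter hG)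

/-- sign-constancy on vertices -/
def SignConst (f : V →ᵃ[ℝ] ℝ) (M : Multiset V) : Prop :=
  (∀ x ∈ M, f x ≤ 0) ∨ (∀ x ∈ M, 0 ≤ f x)

lemma SignConst.mono {f : V →ᵃ[ℝ] ℝ} {M G : Multiset V} (h : SignConst f M)
    (hs : hull G ⊆ hull M) : SignConst f G := by
  rcases h with h | h
  · left; intro x hx; exact hull_nonpos f M h x (hs (mem_hull hx))
  · right; intro x hx; exact hull_nonneg f M h x (hs (mem_hull hx))

lemma cut_half (f : V →ᵃ[ℝ] ℝ) (k : ℕ) : ∀ M : Multiset V,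
    Multiset.card M = Module.finrank ℝ V + 1 → M.countP (fun x => f x ≠ 0) ≤ k →
    ∃ F, Sub M F ∧ ∀ G ∈ F, Multiset.card G = Module.finrank ℝ V + 1 ∧ SignConst f G := by
  induction k with
  | zero =>
    intro M hM hk
    refine ⟨{M}, Sub.refl M, ?_⟩
    intro G hG
    obtain rfl := Multiset.mem_singleton.1 hG
    refine ⟨hM, Or.inl ?_⟩
    intro x hx
    by_contra hn
    have := Multiset.countP_pos (p := fun x => f x ≠ 0) |>.2 ⟨x, hx, fun h => hn h.le⟩
    omega
  | succ k ih =>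
    intro M hM hk
    by_cases hs : SignConst f M
    · refine ⟨{M}, Sub.refl M, ?_⟩
      intro G hG
      obtain rfl := Multiset.mem_singleton.1 hG
      exact ⟨hM, hs⟩
    · simp only [SignConst, not_or, not_forall, not_le] at hs
      obtain ⟨⟨y, hy, hfy⟩, x, hx, hfx⟩ := hs
      obtain ⟨M', rfl⟩ := Multiset.exists_cons_of_mem hx
      have hy' : y ∈ M' := by
        rcases Multiset.mem_cons.1 hy with rfl | h
        · linarith
        · exact h
      obtain ⟨R, rfl⟩ := Multiset.exists_cons_of_mem hy'
      let c := f x / (f x - f y)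
      have hxy : f x - f y < 0 := by linarith
      have hc : c ∈ Icc (0:ℝ) 1 := by
        constructor
        · exact div_nonneg_of_nonpos hfx.le hxy.le
        · rw [div_le_one_of_neg hxy]; linarith
      let m := AffineMap.lineMap x y c
      have hm : m ∈ segment ℝ x y := by
        rw [segment_eq_image_lineMap]; exact ⟨c, hc, rfl⟩
      have hfm : f m = 0 := by
        simp only [m]
        rw [AffineMap.apply_lineMap, AffineMap.lineMap_apply]
        simp only [c, vsub_eq_sub, smul_eq_mul, vadd_eq_add]
        field_simp [hxy.ne]
        ring
      have c1 : Multiset.countP (fun x => f x ≠ 0) (x ::ₘ m ::ₘ R) ≤ k := by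
        simp [hfx.ne, hfy.ne', hfm] at hk ⊢
        omega
      have c2 : Multiset.countP (fun x => f x ≠ 0) (m ::ₘ y ::ₘ R) ≤ k := by
        simp [hfx.ne, hfy.ne', hfm] at hk ⊢
        omega
      obtain ⟨F1, s1, p1⟩ := ih (x ::ₘ m ::ₘ R) (by simpa using hM) c1
      obtain ⟨F2, s2, p2⟩ := ih (m ::ₘ y ::ₘ R) (by simpa using hM) c2
      refine ⟨F1 + F2, Sub.cut hM hm s1 s2, ?_⟩
      intro G hG
      rcases Multiset.mem_add.1 hG with h | h
      · exact p1 G h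
      · exact p2 G h

lemma cut_halves (fs : Finset (V →ᵃ[ℝ] ℝ)) (M : Multiset V)
    (hM : Multiset.card M = Module.finrank ℝ V + 1) :
    ∃ F, Sub M F ∧ ∀ G ∈ F, Nondeg G ∧ ∀ f ∈ fs, SignConst f G := by
  have : ∃ F, Sub M F ∧ ∀ G ∈ F, Multiset.card G = Module.finrank ℝ V + 1 ∧
      ∀ f ∈ fs, SignConst f G := by
    induction fs using Finset.induction_on with
    | empty => exact ⟨{M}, Sub.refl M, by simpa using hM⟩
    | insert f fs hf ih =>
      obtain ⟨F, hF, h⟩ := ih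
      refine hF.bind _ ?_
      intro G hG
      obtain ⟨K, hK, h'⟩ := cut_half f _ G (h G hG).1 le_rfl
      refine ⟨K, hK, fun k hk => ⟨(h' k hk).1, ?_⟩⟩
      intro g hg
      rcases Finset.mem_insert.1 hg with rfl | hg
      · exact (h' k hk).2
      · exact ((h G hG).2 g hg).mono (hK.sub k hk)
  obtain ⟨F, hF, h⟩ := this
  refine ⟨F.filter Nondeg, hF.filter (fun G hG => (h G hG).1), ?_⟩
  intro G hG
  rw [Multiset.mem_filter] at hG
  exact ⟨hG.2, (h G hG.1).2⟩

lemma cut_align_aux (u : V) (hu : u ≠ 0) (k : ℕ) : ∀ N : Multiset (ℝ × V),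
    Multiset.card N = Module.finrank ℝ V + 1 → N.countP (fun x => x.1 ≠ 0) ≤ k →
    (N.map Prod.fst).sum = 0 → (N.map (fun a => a.1 • a.2)).sum = u →
    ∃ F, Sub (N.map Prod.snd) F ∧ ∀ G ∈ F, Multiset.card G = Module.finrank ℝ V + 1 ∧
      ∃ (x y : V) (R : Multiset V) (c : ℝ), 0 < c ∧ y = x + c • u ∧ G = x ::ₘ y ::ₘ R := by
  induction k with
  | zero =>
    intro N hN hk h0 h1
    exfalso
    apply hu
    rw [← h1]
    apply Multiset.sum_eq_zero
    intro z hz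
    obtain ⟨a, ha, rfl⟩ := Multiset.mem_map.1 hz
    have : a.1 = 0 := by
      by_contra hn
      have := Multiset.countP_pos (p := fun x : ℝ × V => x.1 ≠ 0) |>.2 ⟨a, ha, hn⟩
      omega
    simp [this]
  | succ k ih =>
    intro N hN hk h0 h1
    by_cases hs : ∃ a b N', N = a ::ₘ b ::ₘ N' ∧ 0 < a.1 * b.1
    · obtain ⟨⟨α, x⟩, ⟨β, y⟩, N', rfl, hab⟩ := hs
      simp only at hab
      have hα : α ≠ 0 := by rintro rfl; simp at hab
      have hβ : β ≠ 0 := by rintro rfl; simp at hab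
      have hsum : α + β ≠ 0 := by
        intro h
        have : β = -α := by linarith
        subst this
        nlinarith [sq_nonneg α]
      let m : V := (α / (α + β)) • x + (β / (α + β)) • y
      have hpos : 0 ≤ α / (α + β) ∧ 0 ≤ β / (α + β) := by
        rcases pos_and_pos_or_neg_and_neg_of_mul_pos hab with ⟨h, h'⟩ | ⟨h, h'⟩
        · constructor <;> positivity
        · constructor
          · exact div_nonneg_of_nonpos h.le (by linarith)
          · exact div_nonneg_of_nonpos h'.le (by linarith)
      have hm : m ∈ segment ℝ x y :=
        ⟨_, _, hpos.1, hpos.2, by field_simp, rfl⟩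
      have hmm : (α + β) • m = α • x + β • y := by
        simp only [m, smul_add, smul_smul]
        rw [mul_div_cancel₀ _ hsum, mul_div_cancel₀ _ hsum]
      obtain ⟨F1, s1, p1⟩ := ih ((0, x) ::ₘ (α + β, m) ::ₘ N') (by simpa using hN)
        (by simp [hα, hβ, hsum] at hk ⊢; omega)
        (by simp at h0 ⊢; linarith)
        (by simp [hmm] at h1 ⊢; rw [← h1]; abel)
      obtain ⟨F2, s2, p2⟩ := ih ((α + β, m) ::ₘ (0, y) ::ₘ N') (by simpa using hN)
        (by simp [hα, hβ, hsum] at hk ⊢; omega)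
        (by simp at h0 ⊢; linarith)
        (by simp [hmm] at h1 ⊢; rw [← h1]; abel)
      simp only [Multiset.map_cons] at s1 s2 ⊢
      refine ⟨F1 + F2, Sub.cut (by simpa using hN) hm s1 s2, ?_⟩
      intro G hG
      rcases Multiset.mem_add.1 hG with h | h
      · exact p1 G h
      · exact p2 G h
    · refine ⟨_, Sub.refl _, ?_⟩
      intro G hG
      obtain rfl := Multiset.mem_singleton.1 hG
      refine ⟨by simpa using hN, ?_⟩
      have hpair : ∃ a b N', N = a ::ₘ b ::ₘ N' ∧ 0 < a.1 ∧ b.1 < 0 := by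
        have : ∃ c ∈ N, c.1 ≠ 0 := by
          by_contra! hn
          apply hu
          rw [← h1]
          apply Multiset.sum_eq_zero
          intro z hz
          obtain ⟨a, ha, rfl⟩ := Multiset.mem_map.1 hz
          simp [hn a ha]
        obtain ⟨c, hc, hc0⟩ := this
        obtain ⟨N1, rfl⟩ := Multiset.exists_cons_of_mem hc
        simp only [Multiset.map_cons, Multiset.sum_cons] at h0
        rcases lt_or_gt_of_ne hc0 with hlt | hgt
        · have : ∃ d ∈ N1, 0 < d.1 := by
            by_contra! hn
            have : 0 ≤ (N1.map (fun a => - Prod.fst a)).sum := by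
              apply Multiset.sum_nonneg
              intro z hz
              obtain ⟨a, ha, rfl⟩ := Multiset.mem_map.1 hz
              exact neg_nonneg.2 (hn a ha)
            rw [Multiset.sum_map_neg] at this
            linarith
          obtain ⟨d, hd, hd0⟩ := this
          obtain ⟨N2, rfl⟩ := Multiset.exists_cons_of_mem hd
          exact ⟨d, c, N2, Multiset.cons_swap _ _ _, hd0, hlt⟩
        · have : ∃ d ∈ N1, d.1 < 0 := by
            by_contra! hn
            have : 0 ≤ (N1.map Prod.fst).sum := by
              apply Multiset.sum_nonneg
              intro z hz
              obtain ⟨a, ha, rfl⟩ := Multiset.mem_map.1 hz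
              exact hn a ha
            linarith
          obtain ⟨d, hd, hd0⟩ := this
          obtain ⟨N2, rfl⟩ := Multiset.exists_cons_of_mem hd
          exact ⟨c, d, N2, rfl, hgt, hd0⟩
      obtain ⟨⟨α, x⟩, ⟨β, y⟩, N2, rfl, hα, hβ⟩ := hpair
      simp only at hα hβ
      have hz : ∀ c ∈ N2, c.1 = 0 := by
        intro c hc
        obtain ⟨N3, rfl⟩ := Multiset.exists_cons_of_mem hc
        by_contra hne
        apply hs
        rcases lt_or_gt_of_ne hne with hlt | hgt
        · refine ⟨(β, y), c, (α, x) ::ₘ N3, ?_, mul_pos_of_neg_of_neg hβ hlt⟩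
          simp only [← Multiset.singleton_add]; abel
        · refine ⟨(α, x), c, (β, y) ::ₘ N3, ?_, mul_pos hα hgt⟩
          simp only [← Multiset.singleton_add]; abel
      have z1 : (N2.map Prod.fst).sum = 0 := by
        apply Multiset.sum_eq_zero
        intro z hz'
        obtain ⟨a, ha, rfl⟩ := Multiset.mem_map.1 hz'
        exact hz a ha
      have z2 : (N2.map (fun a => a.1 • a.2)).sum = 0 := by
        apply Multiset.sum_eq_zero
        intro z hz'
        obtain ⟨a, ha, rfl⟩ := Multiset.mem_map.1 hz'
        simp [hz a ha]
      simp [z1, z2] at h0 h1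
      refine ⟨y, x, N2.map Prod.snd, α⁻¹, by positivity, ?_, ?_⟩
      · have hb : β = -α := by linarith
        rw [← h1, hb]
        simp [smul_smul, hα.ne']
      · simp [Multiset.cons_swap]

lemma cut_align (u : V) (hu : u ≠ 0) (M : Multiset V) (hM : Nondeg M) :
    ∃ F, Sub M F ∧ ∀ G ∈ F, Nondeg G ∧
      ∃ (x y : V) (R : Multiset V) (c : ℝ), 0 < c ∧ y = x + c • u ∧ G = x ::ₘ y ::ₘ R := by
  obtain ⟨b, hb⟩ := nondeg_basis hM
  let N : Multiset (ℝ × V) := Finset.univ.val.map (fun i => (b.coord i u - b.coord i 0, b i))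
  have hN : N.map Prod.snd = M := by
    simp only [N, Multiset.map_map]; rw [hb]; rfl
  obtain ⟨F, hF, h⟩ := cut_align_aux u hu _ N (by simp [N]) le_rfl
    (by
      simp only [N, Multiset.map_map]
      change ∑ i, (b.coord i u - b.coord i 0) = 0
      rw [Finset.sum_sub_distrib, b.sum_coord_apply_eq_one, b.sum_coord_apply_eq_one, sub_self])
    (by
      simp only [N, Multiset.map_map]
      change ∑ i, (b.coord i u - b.coord i 0) • b i = u
      simp only [sub_smul]
      rw [Finset.sum_sub_distrib, b.linear_combination_coord_eq_self,
        b.linear_combination_coord_eq_self, sub_zero])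
  rw [hN] at hF
  have hF' := hF.filter (fun G hG => (h G hG).1)
  refine ⟨F.filter Nondeg, hF', ?_⟩
  intro G hG
  rw [Multiset.mem_filter] at hG
  exact ⟨hG.2, (h G hG.1).2⟩

end P2
end Star

namespace Star
set_option linter.unusedSectionVars false

section P3
variable {V : Type*} [NormedAddCommGroup V] [NormedSpace ℝ V] [FiniteDimensional ℝ V]
variable {W : Type*} [NormedAddCommGroup W] [NormedSpace ℝ W] [FiniteDimensional ℝ W]
variable {A : Type} [AddCommMonoid A]

lemma flip {Φ : Multiset V → A} (hΦ : IsAdd Φ) {p p' q q' r : V} (R : Multiset V)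
    (h1 : r ∈ segment ℝ p p') (h2 : r ∈ segment ℝ q q') :
    Φ (p ::ₘ p' ::ₘ q ::ₘ R) + Φ (p ::ₘ p' ::ₘ q' ::ₘ R) =
      Φ (q ::ₘ q' ::ₘ p ::ₘ R) + Φ (q ::ₘ q' ::ₘ p' ::ₘ R) := by
  rw [hΦ.cut p p' r _ h1, hΦ.cut p p' r _ h1, hΦ.cut q q' r _ h2, hΦ.cut q q' r _ h2]
  have e1 : p ::ₘ r ::ₘ q ::ₘ R = q ::ₘ r ::ₘ p ::ₘ R := by
    simp only [← Multiset.singleton_add]; abel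
  have e2 : r ::ₘ p' ::ₘ q ::ₘ R = q ::ₘ r ::ₘ p' ::ₘ R := by
    simp only [← Multiset.singleton_add]; abel
  have e3 : p ::ₘ r ::ₘ q' ::ₘ R = r ::ₘ q' ::ₘ p ::ₘ R := by
    simp only [← Multiset.singleton_add]; abel
  have e4 : r ::ₘ p' ::ₘ q' ::ₘ R = r ::ₘ q' ::ₘ p' ::ₘ R := by
    simp only [← Multiset.singleton_add]; abel
  rw [e1, e2, e3, e4]
  abel

/-- lower vertices -/
def lo (l : List (W × ℝ × ℝ)) : Multiset (W × ℝ) := ↑(l.map fun p => (p.1, p.2.1))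
/-- upper vertices -/
def hi (l : List (W × ℝ × ℝ)) : Multiset (W × ℝ) := ↑(l.map fun p => (p.1, p.2.2))

@[simp] lemma lo_nil : lo ([] : List (W × ℝ × ℝ)) = 0 := rfl
@[simp] lemma hi_nil : hi ([] : List (W × ℝ × ℝ)) = 0 := rfl
@[simp] lemma lo_cons (p : W × ℝ × ℝ) (l) : lo (p :: l) = (p.1, p.2.1) ::ₘ lo l := rfl
@[simp] lemma hi_cons (p : W × ℝ × ℝ) (l) : hi (p :: l) = (p.1, p.2.2) ::ₘ hi l := rfl
@[simp] lemma lo_append (l l' : List (W × ℝ × ℝ)) : lo (l ++ l') = lo l + lo l' := by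
  simp [lo]

lemma lo_perm {l l' : List (W × ℝ × ℝ)} (h : l.Perm l') : lo l = lo l' :=
  Multiset.coe_eq_coe.2 (h.map _)

/-- the prism sum -/
def pr (Φ : Multiset (W × ℝ) → A) : Multiset (W × ℝ) → List (W × ℝ × ℝ) → A
  | _, [] => 0
  | K, p :: l => Φ ((p.1, p.2.1) ::ₘ (p.1, p.2.2) ::ₘ (K + lo l)) + pr Φ ((p.1, p.2.2) ::ₘ K) l

@[simp] lemma pr_nil (Φ : Multiset (W × ℝ) → A) (K) : pr Φ K [] = 0 := rfl
lemma pr_cons (Φ : Multiset (W × ℝ) → A) (K) (p) (l) : pr Φ K (p :: l) =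
  Φ ((p.1, p.2.1) ::ₘ (p.1, p.2.2) ::ₘ (K + lo l)) + pr Φ ((p.1, p.2.2) ::ₘ K) l := rfl

variable {Φ : Multiset (W × ℝ) → A}

lemma vert_seg (w : W) {a h b : ℝ} (h1 : a ≤ h) (h2 : h ≤ b) :
    ((w, h) : W × ℝ) ∈ segment ℝ (w, a) (w, b) := by
  have : h ∈ segment ℝ a b := by rw [segment_eq_Icc (h1.trans h2)]; exact ⟨h1, h2⟩
  obtain ⟨c, d, hc, hd, hcd, he⟩ := this
  refine ⟨c, d, hc, hd, hcd, ?_⟩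
  ext
  · simp [← add_smul, hcd]
  · simpa using he

lemma cross (w w' : W) {a b a' b' : ℝ} (h : a ≤ b) (h' : a' ≤ b') :
    ∃ r : W × ℝ, r ∈ segment ℝ (w, b) (w', a') ∧ r ∈ segment ℝ (w, a) (w', b') := by
  by_cases h0 : (b - a) + (b' - a') = 0
  · have h1 : b = a := by linarith
    have h2 : b' = a' := by linarith
    subst h1 h2
    exact ⟨(w, b), left_mem_segment _ _ _, left_mem_segment _ _ _⟩
  · have hp : 0 < (b - a) + (b' - a') := lt_of_le_of_ne (by linarith) (Ne.symm h0)
    set D := (b - a) + (b' - a') with hD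
    have e1 : 0 ≤ (b' - a') / D := div_nonneg (by linarith) hp.le
    have e2 : 0 ≤ (b - a) / D := div_nonneg (by linarith) hp.le
    have e3 : (b' - a') / D + (b - a) / D = 1 := by
      rw [← add_div, div_eq_one_iff_eq h0]; linarith
    refine ⟨((b' - a') / D) • (w, b) + ((b - a) / D) • (w', a'), ⟨_, _, e1, e2, e3, rfl⟩,
      ⟨_, _, e1, e2, e3, ?_⟩⟩
    ext
    · simp
    · simp only [Prod.smul_mk, Prod.mk_add_mk, smul_eq_mul]
      field_simp
      ring

lemma pr_swap (hΦ : IsAdd Φ) (K) (x y : W × ℝ × ℝ) (l) (hx : x.2.1 ≤ x.2.2)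
    (hy : y.2.1 ≤ y.2.2) : pr Φ K (x :: y :: l) = pr Φ K (y :: x :: l) := by
  obtain ⟨w, a, b⟩ := x
  obtain ⟨w', a', b'⟩ := y
  simp only at hx hy
  obtain ⟨r, h1, h2⟩ := cross w w' hx hy
  simp only [pr_cons, lo_cons]
  have := flip hΦ (K + lo l) h1 h2
  rw [Multiset.cons_swap (w, b) (w', b'), ← add_assoc, ← add_assoc]
  congr 1
  have e1 : (w, a) ::ₘ (w, b) ::ₘ (K + (w', a') ::ₘ lo l) =
    (w, b) ::ₘ (w', a') ::ₘ (w, a) ::ₘ (K + lo l) := by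
    simp only [← Multiset.singleton_add]; abel
  have e2 : (w', a') ::ₘ (w', b') ::ₘ ((w, b) ::ₘ K + lo l) =
    (w, b) ::ₘ (w', a') ::ₘ (w', b') ::ₘ (K + lo l) := by
    simp only [← Multiset.singleton_add]; abel
  have e3 : (w', a') ::ₘ (w', b') ::ₘ (K + (w, a) ::ₘ lo l) =
    (w, a) ::ₘ (w', b') ::ₘ (w', a') ::ₘ (K + lo l) := by
    simp only [← Multiset.singleton_add]; abel
  have e4 : (w, a) ::ₘ (w, b) ::ₘ ((w', b') ::ₘ K + lo l) =
    (w, a) ::ₘ (w', b') ::ₘ (w, b) ::ₘ (K + lo l) := by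
    simp only [← Multiset.singleton_add]; abel
  rw [e1, e2, e3, e4, this, add_comm]

lemma pr_perm (hΦ : IsAdd Φ) {l l' : List (W × ℝ × ℝ)} (h : l.Perm l') :
    ∀ K, (∀ p ∈ l, p.2.1 ≤ p.2.2) → pr Φ K l = pr Φ K l' := by
  induction h with
  | nil => simp
  | cons x h ih =>
    intro K hl
    rw [pr_cons, pr_cons, lo_perm h, ih _ (fun p hp => hl p (by simp [hp]))]
  | swap x y l =>
    intro K hl
    exact pr_swap hΦ K _ _ _ (hl _ (by simp)) (hl _ (by simp))
  | trans h1 h2 ih1 ih2 =>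
    intro K hl
    rw [ih1 K hl, ih2 K (fun p hp => hl p (h1.symm.subset hp))]

lemma pr_concat (q : W × ℝ × ℝ) (l : List (W × ℝ × ℝ)) : ∀ K,
    pr Φ K (l ++ [q]) = pr Φ ((q.1, q.2.1) ::ₘ K) l +
      Φ ((q.1, q.2.1) ::ₘ (q.1, q.2.2) ::ₘ (K + hi l)) := by
  induction l with
  | nil => intro K; simp [pr_cons]
  | cons p l ih =>
    intro K
    rw [List.cons_append, pr_cons, pr_cons, ih]
    rw [Multiset.cons_swap (q.1, q.2.1) (p.1, p.2.2), ← add_assoc]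
    congr 2
    · congr 1
      simp only [lo_append, lo_cons, lo_nil, ← Multiset.singleton_add]; abel
    · simp only [hi_cons, ← Multiset.singleton_add]; abel

/-- heights selection -/
def sel (i j : W → ℝ) (l : List W) : List (W × ℝ × ℝ) := l.map fun w => (w, i w, j w)

@[simp] lemma sel_nil (i j : W → ℝ) : sel i j [] = [] := rfl
@[simp] lemma sel_cons (i j : W → ℝ) (w l) : sel i j (w :: l) = (w, i w, j w) :: sel i j l := rfl

lemma lo_sel (i j j' : W → ℝ) (l) : lo (sel i j l) = lo (sel i j' l) := by
  simp [lo, sel, Function.comp_def]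
lemma hi_sel (i i' j : W → ℝ) (l) : hi (sel i j l) = hi (sel i' j l) := by
  simp [hi, sel, Function.comp_def]

lemma sel_le {i j : W → ℝ} {l} (h : ∀ w ∈ l, i w ≤ j w) : ∀ p ∈ sel i j l, p.2.1 ≤ p.2.2 := by
  intro p hp
  obtain ⟨w, hw, rfl⟩ := List.mem_map.1 hp
  exact h w hw

lemma pr_trans (hΦ : IsAdd Φ) {a b c : W → ℝ} (l : List W) (hab : ∀ w ∈ l, a w ≤ b w)
    (hbc : ∀ w ∈ l, b w ≤ c w) : ∀ K,
    pr Φ K (sel a b l) + pr Φ K (sel b c l) = pr Φ K (sel a c l) := by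
  induction l with
  | nil => intro K; simp
  | cons w l ih =>
    intro K
    have hab' : ∀ w ∈ l, a w ≤ b w := fun w hw => hab w (by simp [hw])
    have hbc' : ∀ w ∈ l, b w ≤ c w := fun w hw => hbc w (by simp [hw])
    have hw1 := hab w (by simp)
    have hw2 := hbc w (by simp)
    have ih := ih hab' hbc'
    have p1 : pr Φ K (sel b c (w :: l)) = pr Φ K (sel b c l ++ [(w, b w, c w)]) := by
      apply pr_perm hΦ _ K (sel_le hbc)
      rw [sel_cons]
      exact (List.perm_append_singleton _ _).symm
    have p2 : pr Φ K (sel a c l ++ [(w, b w, c w)]) = pr Φ K ((w, b w, c w) :: sel a c l) := by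
      apply pr_perm hΦ (List.perm_append_singleton _ _)
      intro p hp
      rcases List.mem_append.1 hp with h | h
      · exact sel_le (fun w hw => (hab' w hw).trans (hbc' w hw)) p h
      · simp only [List.mem_singleton] at h; subst h; exact hw2
    rw [p1, pr_concat, sel_cons, pr_cons, add_assoc, ← add_assoc (pr _ _ _), ih]
    rw [hi_sel b a, ← pr_concat (w, b w, c w), p2, sel_cons, pr_cons, pr_cons, ← add_assoc]
    congr 1
    simp only
    rw [lo_sel a b c, hΦ.cut (w, a w) (w, c w) (w, b w) _ (vert_seg w hw1 hw2)]

lemma nondeg_proj {w : W} {a b : ℝ} {Q : Multiset (W × ℝ)}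
    (h : Nondeg ((w, a) ::ₘ (w, b) ::ₘ Q)) : Nondeg (w ::ₘ Q.map Prod.fst) := by
  refine ⟨?_, ?_⟩
  · have := h.1
    simp at this ⊢
    exact this
  · have h2 := h.2
    have := congrArg (AffineSubspace.map (LinearMap.fst ℝ W ℝ).toAffineMap) h2
    rw [AffineSubspace.map_span, AffineMap.map_top_of_surjective] at this
    · rw [← this]
      congr 1
      ext z
      simp [vs]
      constructor
      · rintro (rfl | ⟨x, hx⟩)
        · simp
        · exact Or.inr ⟨x, hx⟩
      · rintro (rfl | ⟨x, hx⟩)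
        · simp
        · exact Or.inr ⟨x, hx⟩
    · exact fun w => ⟨(w, 0), rfl⟩

lemma pr_zero (hΦ : IsAdd Φ) (l : List (W × ℝ × ℝ)) : ∀ K : Multiset (W × ℝ),
    ¬ Nondeg (K.map Prod.fst + (↑(l.map Prod.fst) : Multiset W)) → pr Φ K l = 0 := by
  induction l with
  | nil => simp
  | cons p l ih =>
    intro K h
    rw [pr_cons, hΦ.deg, ih, add_zero]
    · intro h'; apply h
      convert h' using 1
      simp only [List.map_cons, ← Multiset.cons_coe,
        ← Multiset.singleton_add, Multiset.map_add, Multiset.map_singleton]; abel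
    · intro h'; apply h
      convert nondeg_proj h' using 1
      simp only [List.map_cons, ← Multiset.cons_coe, Multiset.map_add, lo, Multiset.map_coe,
        List.map_map, ← Multiset.singleton_add]
      rw [← add_assoc, add_comm (Multiset.map _ _), add_assoc]
      rfl

lemma pr_cut_K (hΦ : IsAdd Φ) {x y m : W × ℝ} (hm : m ∈ segment ℝ x y) (l : List (W × ℝ × ℝ)) :
    ∀ K, pr Φ (x ::ₘ y ::ₘ K) l = pr Φ (x ::ₘ m ::ₘ K) l + pr Φ (m ::ₘ y ::ₘ K) l := by
  induction l with
  | nil => simp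
  | cons p l ih =>
    intro K
    have key : ∀ u v : W × ℝ, pr Φ (u ::ₘ v ::ₘ K) (p :: l) =
        Φ (u ::ₘ v ::ₘ (p.1, p.2.1) ::ₘ (p.1, p.2.2) ::ₘ (K + lo l)) +
        pr Φ (u ::ₘ v ::ₘ (p.1, p.2.2) ::ₘ K) l := by
      intro u v
      rw [pr_cons]
      congr 2
      · simp only [← Multiset.singleton_add]; abel
      · simp only [← Multiset.singleton_add]; abel
    rw [key, key, key, hΦ.cut x y m _ hm, ih]
    abel

lemma graph_seg (s : W →ᵃ[ℝ] ℝ) {x y m : W} (hm : m ∈ segment ℝ x y) :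
    ((m, s m) : W × ℝ) ∈ segment ℝ (x, s x) (y, s y) := by
  obtain ⟨a, b, ha, hb, hab, h1, h2⟩ := affine_seg s hm
  exact ⟨a, b, ha, hb, hab, by ext <;> simp [h1, h2]⟩

lemma pr_edge (hΦ : IsAdd Φ) (s t : W →ᵃ[ℝ] ℝ) {x y m : W} (hm : m ∈ segment ℝ x y)
    (hx : s x ≤ t x) (hy : s y ≤ t y) (l : List (W × ℝ × ℝ)) (K) :
    pr Φ K ((x, s x, t x) :: (y, s y, t y) :: l) =
      pr Φ K ((x, s x, t x) :: (m, s m, t m) :: l) +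
      pr Φ K ((m, s m, t m) :: (y, s y, t y) :: l) := by
  have e : ∀ u v : W, pr Φ K ((u, s u, t u) :: (v, s v, t v) :: l) =
      Φ ((u, s u) ::ₘ (v, s v) ::ₘ (u, t u) ::ₘ (K + lo l)) +
      Φ ((u, t u) ::ₘ (v, t v) ::ₘ (v, s v) ::ₘ (K + lo l)) +
      pr Φ ((u, t u) ::ₘ (v, t v) ::ₘ K) l := by
    intro u v
    rw [pr_cons, pr_cons, ← add_assoc]
    congr 2
    · congr 1
      simp only [lo_cons, ← Multiset.singleton_add]; abel
    · congr 1
      simp only [← Multiset.singleton_add]; abel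
    · simp only [← Multiset.singleton_add]; abel
  rw [e x y, e x m, e m y, pr_cut_K hΦ (graph_seg t hm)]
  have hs := graph_seg s hm
  have ht := graph_seg t hm
  rw [hΦ.cut _ _ _ _ hs, hΦ.cut _ _ _ _ ht]
  have hr : ∃ r : W × ℝ, r ∈ segment ℝ (x, t x) (y, s y) ∧ r ∈ segment ℝ (m, s m) (m, t m) := by
    obtain ⟨a, b, ha, hb, hab, h1, h2⟩ := affine_seg s hm
    have h3 : t m = a * t x + b * t y := by
      rw [← h1]
      have := Convex.combo_affine_apply (f := t) (x := x) (y := y) hab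
      simpa using this
    refine ⟨(m, a * t x + b * s y), ⟨a, b, ha, hb, hab, by ext <;> simp [h1]⟩, vert_seg _ ?_ ?_⟩
    · rw [h2]; nlinarith
    · rw [h3]; nlinarith
  obtain ⟨r, r1, r2⟩ := hr
  have fl := flip hΦ (K + lo l) r1 r2
  have f1 : (m, s m) ::ₘ (y, s y) ::ₘ (x, t x) ::ₘ (K + lo l) =
    (x, t x) ::ₘ (y, s y) ::ₘ (m, s m) ::ₘ (K + lo l) := by
    simp only [← Multiset.singleton_add]; abel
  have f2 : (x, t x) ::ₘ (m, t m) ::ₘ (y, s y) ::ₘ (K + lo l) =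
    (x, t x) ::ₘ (y, s y) ::ₘ (m, t m) ::ₘ (K + lo l) := by
    simp only [← Multiset.singleton_add]; abel
  have f3 : (x, t x) ::ₘ (m, t m) ::ₘ (m, s m) ::ₘ (K + lo l) =
    (m, s m) ::ₘ (m, t m) ::ₘ (x, t x) ::ₘ (K + lo l) := by
    simp only [← Multiset.singleton_add]; abel
  have f4 : (m, s m) ::ₘ (y, s y) ::ₘ (m, t m) ::ₘ (K + lo l) =
    (m, s m) ::ₘ (m, t m) ::ₘ (y, s y) ::ₘ (K + lo l) := by
    simp only [← Multiset.singleton_add]; abel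
  rw [f3, f4, f1, f2]
  set a1 := Φ ((x, t x) ::ₘ (y, s y) ::ₘ (m, s m) ::ₘ (K + lo l))
  set a2 := Φ ((x, t x) ::ₘ (y, s y) ::ₘ (m, t m) ::ₘ (K + lo l))
  set b1 := Φ ((m, s m) ::ₘ (m, t m) ::ₘ (x, t x) ::ₘ (K + lo l))
  set b2 := Φ ((m, s m) ::ₘ (m, t m) ::ₘ (y, s y) ::ₘ (K + lo l))
  have : ∀ c1 c2 c3 c4 : A, c1 + a1 + (a2 + c2) + (c3 + c4) = c1 + b1 + c3 + (b2 + c2 + c4) := by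
    intro c1 c2 c3 c4
    have : c1 + a1 + (a2 + c2) + (c3 + c4) = (a1 + a2) + (c1 + c2 + c3 + c4) := by abel
    rw [this, fl]; abel
  exact this _ _ _ _

/-- prism over a simplex -/
def prism (Φ : Multiset (W × ℝ) → A) (s t : W →ᵃ[ℝ] ℝ) (e : Multiset W) : A :=
  pr Φ 0 (sel s t e.toList)

lemma prism_coe (hΦ : IsAdd Φ) (s t : W →ᵃ[ℝ] ℝ) (l : List W) (h : ∀ w ∈ l, s w ≤ t w) :
    prism Φ s t (l : Multiset W) = pr Φ 0 (sel s t l) := by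
  apply pr_perm hΦ
  · exact List.Perm.map _ (Multiset.coe_eq_coe.1 (Multiset.coe_toList _))
  · apply sel_le
    intro w hw
    apply h
    rw [Multiset.mem_toList] at hw
    exact hw

lemma prism_deg (hΦ : IsAdd Φ) (s t : W →ᵃ[ℝ] ℝ) (e : Multiset W) (h : ¬ Nondeg e) :
    prism Φ s t e = 0 := by
  apply pr_zero hΦ
  convert h
  simp [sel, Function.comp_def]

lemma prism_cut (hΦ : IsAdd Φ) (s t : W →ᵃ[ℝ] ℝ) {x y m : W} {R : Multiset W}
    (hm : m ∈ segment ℝ x y) (h : ∀ w ∈ x ::ₘ y ::ₘ R, s w ≤ t w) :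
    prism Φ s t (x ::ₘ y ::ₘ R) = prism Φ s t (x ::ₘ m ::ₘ R) + prism Φ s t (m ::ₘ y ::ₘ R) := by
  have hx := h x (by simp)
  have hy := h y (by simp)
  have hmm : s m ≤ t m := by
    obtain ⟨a, b, ha, hb, hab, h1, h2⟩ := affine_seg (t - s) hm
    simp at h2
    nlinarith
  induction R using Quotient.inductionOn with
  | h l =>
    simp only [Multiset.quot_mk_to_coe, Multiset.cons_coe] at h ⊢
    have hl : ∀ w ∈ l, s w ≤ t w := fun w hw => h w (by simp [hw])
    rw [prism_coe hΦ, prism_coe hΦ, prism_coe hΦ]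
    · exact pr_edge hΦ s t hm hx hy _ _
    · simp; exact ⟨hmm, hy, hl⟩
    · simp; exact ⟨hx, hmm, hl⟩
    · simp; exact ⟨hx, hy, hl⟩

/-- prism functional with top value for bad simplices -/
def Psi (Φ : Multiset (W × ℝ) → A) (s t : W →ᵃ[ℝ] ℝ) (e : Multiset W) : WithTop A :=
  if Nondeg e ∧ ¬ (∀ w ∈ e, s w ≤ t w) then ⊤ else (prism Φ s t e : A)

lemma Psi_good (s t : W →ᵃ[ℝ] ℝ) (e : Multiset W) (h : ∀ w ∈ e, s w ≤ t w) :
    Psi Φ s t e = (prism Φ s t e : A) := by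
  rw [Psi, if_neg]; tauto

lemma Psi_isAdd (hΦ : IsAdd Φ) (s t : W →ᵃ[ℝ] ℝ) : IsAdd (Psi Φ s t) := by
  have hdeg : ∀ M, ¬ Nondeg M → Psi Φ s t M = 0 := by
    intro M hM
    rw [Psi, if_neg (by tauto), prism_deg hΦ _ _ _ hM]
    rfl
  refine ⟨hdeg, ?_⟩
  intro x y m R hm
  by_cases hN : Nondeg (x ::ₘ y ::ₘ R)
  · by_cases hx : m = x
    · subst hx
      rw [hdeg _ (not_nondeg_dup m R), zero_add]
    by_cases hy : m = y
    · subst hy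
      rw [hdeg _ (not_nondeg_dup m R), add_zero]
    have n1 := nondeg_cut_left hN hm hx
    have n2 := nondeg_cut_right hN hm hy
    by_cases hg : ∀ w ∈ x ::ₘ y ::ₘ R, s w ≤ t w
    · have hmm : s m ≤ t m := by
        obtain ⟨a, b, ha, hb, hab, h1, h2⟩ := affine_seg (t - s) hm
        have hx := hg x (by simp)
        have hy := hg y (by simp)
        simp at h2
        nlinarith
      rw [Psi_good _ _ _ hg, Psi_good, Psi_good, prism_cut hΦ s t hm hg]
      · rfl
      · simp at hg ⊢; exact ⟨hmm, hg.2⟩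
      · simp at hg ⊢; exact ⟨hg.1, hmm, hg.2.2⟩
    · rw [Psi, if_pos ⟨hN, hg⟩]
      push Not at hg
      obtain ⟨w, hw, hlt⟩ := hg
      have bad : ∀ e : Multiset W, Nondeg e → w ∈ e → Psi Φ s t e = ⊤ := by
        intro e he hwe
        rw [Psi, if_pos ⟨he, fun h => absurd (h w hwe) (not_le.2 hlt)⟩]
      simp only [Multiset.mem_cons] at hw
      rcases hw with rfl | rfl | hw
      · rw [bad _ n1 (by simp), WithTop.top_add]
      · rw [bad _ n2 (by simp), WithTop.add_top]
      · rw [bad _ n1 (by simp [hw]), WithTop.top_add]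
  · rw [hdeg _ hN, hdeg, hdeg, add_zero]
    · exact fun h => hN (nondeg_of_cut_right h hm)
    · exact fun h => hN (nondeg_of_cut_left h hm)

end P3
end Star

namespace Star
set_option linter.unusedSectionVars false

section P4
variable {V : Type*} [NormedAddCommGroup V] [NormedSpace ℝ V] [FiniteDimensional ℝ V]
variable {W : Type*} [NormedAddCommGroup W] [NormedSpace ℝ W] [FiniteDimensional ℝ W]
variable {A : Type} [AddCommMonoid A]
variable {Φ : Multiset (W × ℝ) → A}

/-- a column: base simplex, lower and upper height -/
structure Col (W : Type*) [NormedAddCommGroup W] [NormedSpace ℝ W] where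
  base : Multiset W
  s : W →ᵃ[ℝ] ℝ
  t : W →ᵃ[ℝ] ℝ

/-- admissible columns -/
def Col.Good (D : Col W) : Prop := Nondeg D.base ∧ ∀ w ∈ D.base, D.s w ≤ D.t w

/-- the region of a column -/
def Col.reg (D : Col W) : Set (W × ℝ) := {q | q.1 ∈ hull D.base ∧ D.s q.1 ≤ q.2 ∧ q.2 ≤ D.t q.1}

lemma pr_flat (hΦ : IsAdd Φ) (l : List (W × ℝ × ℝ)) : ∀ K, (∀ p ∈ l, p.2.1 = p.2.2) →
    pr Φ K l = 0 := by
  induction l with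
  | nil => simp
  | cons p l ih =>
    intro K h
    rw [pr_cons, ih _ (fun q hq => h q (by simp [hq])), h p (by simp),
      hΦ.deg _ (not_nondeg_dup _ _), add_zero]

/-- a hyperplane through all but one vertex of an aligned simplex is a graph -/
lemma exists_graph {w : W} {a b : ℝ} {R : Multiset (W × ℝ)}
    (h : Nondeg ((w, a) ::ₘ (w, b) ::ₘ R)) :
    ∃ s : W →ᵃ[ℝ] ℝ, s w = a ∧ ∀ r ∈ R, s r.1 = r.2 := by
  have hs : affineSpan ℝ (vs ((w, a) ::ₘ R)) ≠ ⊤ := span_ne_top_of_card _ (by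
    have := h.1; simp only [Multiset.card_cons] at this ⊢; omega)
  obtain ⟨f, hf, h0⟩ := exists_vanish _ hs
  have ha : f (w, a) = 0 := h0 _ (by simp)
  have hR : ∀ r ∈ R, f r = 0 := fun r hr => h0 r (by simp [show r ∈ vs R from hr])
  have hexp : ∀ (p : W) (k : ℝ), f (p, k) = f (p, 0) + k * f.linear (0, 1) := by
    intro p k
    have h1 := f.map_vadd (p, 0) (k • ((0 : W), (1 : ℝ)))
    rw [map_smul] at h1
    simp only [vadd_eq_add, smul_eq_mul, Prod.smul_mk, smul_zero, mul_one, Prod.mk_add_mk, zero_add,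
      add_zero] at h1
    rw [h1, add_comm]
  have hk : f.linear (0, 1) ≠ 0 := by
    intro hk
    apply hf
    apply nondeg_ext h
    intro z hz
    simp only [Multiset.mem_cons] at hz
    rcases hz with rfl | rfl | hz
    · simpa using ha
    · rw [hexp] at ha ⊢
      rw [hk] at ha ⊢
      simpa using ha
    · simpa using hR z hz
  let g : W →ᵃ[ℝ] ℝ := f.comp ((AffineMap.id ℝ W).prod (AffineMap.const ℝ W 0))
  have hg : ∀ p, g p = f (p, 0) := fun p => rfl
  refine ⟨(-(f.linear (0, 1))⁻¹) • g, ?_, ?_⟩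
  · have := hexp w a
    rw [ha] at this
    rw [AffineMap.coe_smul, Pi.smul_apply, hg, smul_eq_mul]
    field_simp
    linarith
  · rintro ⟨p, k⟩ hr
    have := hexp p k
    rw [hR _ hr] at this
    rw [AffineMap.coe_smul, Pi.smul_apply, hg, smul_eq_mul]
    field_simp
    linarith

lemma graph_hull (s : W →ᵃ[ℝ] ℝ) (Q : Multiset (W × ℝ)) (h : ∀ r ∈ Q, s r.1 = r.2) {p : W}
    (hp : p ∈ hull (Q.map Prod.fst)) : (p, s p) ∈ hull Q := by
  let g : W →ᵃ[ℝ] W × ℝ := (AffineMap.id ℝ W).prod s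
  have h1 : g p ∈ g '' hull (Q.map Prod.fst) := mem_image_of_mem _ hp
  rw [hull, AffineMap.image_convexHull] at h1
  refine convexHull_mono ?_ h1
  rintro _ ⟨w, hw, rfl⟩
  obtain ⟨r, hr, rfl⟩ := Multiset.mem_map.1 hw
  have : g r.1 = r := by
    ext
    · rfl
    · exact h r hr
  rw [this]; exact hr

lemma exists_col {G : Multiset (W × ℝ)} (hG : Nondeg G) {x y : W × ℝ} {R : Multiset (W × ℝ)} {c : ℝ}
    (hc : 0 < c) (hy : y = x + c • (0, 1)) (hGR : G = x ::ₘ y ::ₘ R) :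
    ∃ D : Col W, D.Good ∧ hull G = D.reg ∧
      ∀ (A : Type) [AddCommMonoid A] (Φ : Multiset (W × ℝ) → A), IsAdd Φ →
        Φ G = prism Φ D.s D.t D.base := by
  obtain ⟨w, a⟩ := x
  have hy' : y = (w, a + c) := by rw [hy]; ext <;> simp
  subst hGR
  subst hy'
  clear hy
  obtain ⟨s, hs1, hs2⟩ := exists_graph hG
  obtain ⟨t, ht1, ht2⟩ := exists_graph (by rw [Multiset.cons_swap] at hG; exact hG)
  have hgood : ∀ v ∈ w ::ₘ R.map Prod.fst, s v ≤ t v := by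
    intro v hv
    rcases Multiset.mem_cons.1 hv with rfl | hv
    · rw [hs1, ht1]; linarith
    · obtain ⟨r, hr, rfl⟩ := Multiset.mem_map.1 hv
      rw [hs2 r hr, ht2 r hr]
  refine ⟨⟨w ::ₘ R.map Prod.fst, s, t⟩, ⟨nondeg_proj hG, hgood⟩, ?_, ?_⟩
  · apply subset_antisymm
    · have hconv : Convex ℝ (Col.reg ⟨w ::ₘ R.map Prod.fst, s, t⟩) := by
        have h1 : Convex ℝ {q : W × ℝ | q.1 ∈ hull (w ::ₘ R.map Prod.fst)} :=
          (convex_convexHull ℝ (vs (w ::ₘ R.map Prod.fst))).is_linear_preimage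
            (LinearMap.fst ℝ W ℝ).isLinear
        let f1 : W × ℝ →ᵃ[ℝ] ℝ := (LinearMap.snd ℝ W ℝ).toAffineMap -
          s.comp (LinearMap.fst ℝ W ℝ).toAffineMap
        let f2 : W × ℝ →ᵃ[ℝ] ℝ := t.comp (LinearMap.fst ℝ W ℝ).toAffineMap -
          (LinearMap.snd ℝ W ℝ).toAffineMap
        have h2 := (convex_Ici (0:ℝ)).affine_preimage f1
        have h3 := (convex_Ici (0:ℝ)).affine_preimage f2
        have := h1.inter (h2.inter h3)
        convert this using 1
        ext q
        simp [Col.reg, f1, f2]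
      refine convexHull_min ?_ hconv
      intro z hz
      simp only [vs_cons, mem_insert_iff] at hz
      rcases hz with rfl | rfl | hz
      · exact ⟨mem_hull (by simp), hs1.le, by simp only [ht1]; linarith⟩
      · exact ⟨mem_hull (by simp), by simp only [hs1]; linarith, ht1.ge⟩
      · exact ⟨mem_hull (Multiset.mem_cons_of_mem (Multiset.mem_map_of_mem _ hz)),
          (hs2 z hz).le, (ht2 z hz).ge⟩
    · rintro ⟨p, k⟩ ⟨h1, h2, h3⟩
      simp only at h1 h2 h3
      have k1 : (p, s p) ∈ hull ((w, a) ::ₘ R) := by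
        apply graph_hull s _ _ (by simpa using h1)
        intro r hr
        rcases Multiset.mem_cons.1 hr with rfl | hr
        · exact hs1
        · exact hs2 r hr
      have k2 : (p, t p) ∈ hull ((w, a + c) ::ₘ R) := by
        apply graph_hull t _ _ (by simpa using h1)
        intro r hr
        rcases Multiset.mem_cons.1 hr with rfl | hr
        · exact ht1
        · exact ht2 r hr
      have k1' : (p, s p) ∈ hull ((w, a) ::ₘ (w, a + c) ::ₘ R) := by
        refine convexHull_mono ?_ k1
        simp only [vs_cons]
        exact insert_subset_insert (subset_insert _ _)
      have k2' : (p, t p) ∈ hull ((w, a) ::ₘ (w, a + c) ::ₘ R) := by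
        refine convexHull_mono ?_ k2
        simp only [vs_cons]
        exact subset_insert _ _
      exact (convex_convexHull ℝ _).segment_subset k1' k2' (vert_seg p h2 h3)
  · intro A _ Φ hΦ
    revert hs2 ht2 hgood hG
    induction R using Quotient.inductionOn with
    | h l =>
      intro hG hs2 ht2 hgood
      simp only [Multiset.quot_mk_to_coe, Multiset.map_coe, Multiset.cons_coe, Multiset.mem_coe]
        at hs2 ht2 hgood ⊢
      rw [prism_coe hΦ _ _ _ hgood, sel_cons, pr_cons, pr_flat hΦ, add_zero]
      · simp only [hs1, ht1]
        have : lo (sel s t (l.map Prod.fst)) = ↑l := by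
          simp only [lo, sel, List.map_map]
          congr 1
          conv_rhs => rw [← List.map_id l]
          apply List.map_congr_left
          intro r hr
          ext
          · rfl
          · exact hs2 r hr
        rw [this]
        simp
      · intro p hp
        simp only [sel, List.map_map, List.mem_map] at hp
        obtain ⟨r, hr, rfl⟩ := hp
        simp [hs2 r hr, ht2 r hr]

/-- column counting -/
def ccnt (C : Multiset (Col W)) (x : W × ℝ) : ℕ :=
  (C.map (fun D => if x ∈ D.reg then 1 else 0)).sum

lemma exists_cols (F : Multiset (Multiset (W × ℝ))) : (∀ M ∈ F, Nondeg M) →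
    ∃ C : Multiset (Col W), (∀ D ∈ C, D.Good) ∧ (∀ᶠ x in gen (W × ℝ), cnt F x = ccnt C x) ∧
      ∀ (A : Type) [AddCommMonoid A] (Φ : Multiset (W × ℝ) → A), IsAdd Φ →
        (F.map Φ).sum = (C.map (fun D => prism Φ D.s D.t D.base)).sum := by
  have step : ∀ F : Multiset (Multiset (W × ℝ)), (∀ G ∈ F, ∃ D : Col W, D.Good ∧ hull G = D.reg ∧
      ∀ (A : Type) [AddCommMonoid A] (Φ : Multiset (W × ℝ) → A), IsAdd Φ →
        Φ G = prism Φ D.s D.t D.base) → ∃ C : Multiset (Col W), (∀ D ∈ C, D.Good) ∧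
      (∀ x, cnt F x = ccnt C x) ∧
      ∀ (A : Type) [AddCommMonoid A] (Φ : Multiset (W × ℝ) → A), IsAdd Φ →
        (F.map Φ).sum = (C.map (fun D => prism Φ D.s D.t D.base)).sum := by
    intro F
    induction F using Multiset.induction_on with
    | empty => intro _; exact ⟨0, by simp, by simp [ccnt], by simp⟩
    | cons G F ih =>
      intro h
      obtain ⟨C, c1, c2, c3⟩ := ih (fun G' h' => h G' (by simp [h']))
      obtain ⟨D, d1, d2, d3⟩ := h G (by simp)
      refine ⟨D ::ₘ C, by simpa using ⟨d1, c1⟩, ?_, ?_⟩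
      · intro x
        simp [c2, ccnt, d2]
      · intro A _ Φ hΦ
        simp [c3 A Φ hΦ, d3 A Φ hΦ]
  induction F using Multiset.induction_on with
  | empty => intro _; exact ⟨0, by simp, by simp [ccnt], by simp⟩
  | cons M F ih =>
    intro h
    obtain ⟨C, c1, c2, c3⟩ := ih (fun G' h' => h G' (by simp [h']))
    obtain ⟨K, k1, k2⟩ := cut_align ((0 : W), (1 : ℝ)) (by simp) M (h M (by simp))
    obtain ⟨C', d1, d2, d3⟩ := step K (by
      intro G hG
      obtain ⟨n1, x, y, R, c, hc, hy, hGR⟩ := k2 G hG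
      exact exists_col n1 hc hy hGR)
    refine ⟨C' + C, ?_, ?_, ?_⟩
    · intro D hD
      rcases Multiset.mem_add.1 hD with h | h
      · exact d1 D h
      · exact c1 D h
    · filter_upwards [c2, k1.count] with x h1 h2
      rw [cnt_cons, h2, h1, d2]
      simp [ccnt]
    · intro A _ Φ hΦ
      simp [k1.add A Φ hΦ, d3 A Φ hΦ, c3 A Φ hΦ]

end P4
end Star

namespace Star
set_option linter.unusedSectionVars false

section P5
variable {V : Type*} [NormedAddCommGroup V] [NormedSpace ℝ V] [FiniteDimensional ℝ V]
variable {W : Type*} [NormedAddCommGroup W] [NormedSpace ℝ W] [FiniteDimensional ℝ W]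
variable {A : Type} [AddCommMonoid A]
variable {Φ : Multiset (W × ℝ) → A}

/-- successor in a finite set -/
def nxt (X : Finset ℝ) (c : ℝ) : ℝ :=
  if h : (X.filter (c < ·)).Nonempty then (X.filter (c < ·)).min' h else c

lemma nxt_spec (X : Finset ℝ) {c y : ℝ} (hy : y ∈ X) (h : c < y) :
    nxt X c ∈ X ∧ c < nxt X c ∧ ∀ z ∈ X, c < z → nxt X c ≤ z := by
  have hne : (X.filter (c < ·)).Nonempty := ⟨y, by simp [hy, h]⟩
  rw [nxt, dif_pos hne]
  have := Finset.min'_mem _ hne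
  rw [Finset.mem_filter] at this
  refine ⟨this.1, this.2, ?_⟩
  intro z hz hcz
  exact Finset.min'_le _ _ (by simp [hz, hcz])

lemma line_repr (X : Finset ℝ) (P : ℝ → ℝ → A) (h0 : ∀ x, P x x = 0)
    (hP : ∀ x ∈ X, ∀ y ∈ X, ∀ z ∈ X, x ≤ y → y ≤ z → P x y + P y z = P x z) (k : ℕ) :
    ∀ x ∈ X, ∀ y ∈ X, x ≤ y → (X.filter (fun c => x ≤ c ∧ c < y)).card ≤ k →
      P x y = ∑ c ∈ X, if x ≤ c ∧ c < y then P c (nxt X c) else 0 := by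
  induction k with
  | zero =>
    intro x hx y hy hxy hk
    have : x = y := by
      by_contra hne
      have : x ∈ X.filter (fun c => x ≤ c ∧ c < y) := by
        simp [hx, lt_of_le_of_ne hxy hne]
      have := Finset.card_pos.2 ⟨x, this⟩
      omega
    subst this
    rw [h0, Finset.sum_eq_zero]
    intro c _
    rw [if_neg]; rintro ⟨a, b⟩; linarith
  | succ k ih =>
    intro x hx y hy hxy hk
    rcases hxy.eq_or_lt with rfl | hlt
    · rw [h0, Finset.sum_eq_zero]
      intro c _
      rw [if_neg]; rintro ⟨a, b⟩; linarith
    obtain ⟨n1, n2, n3⟩ := nxt_spec X hy hlt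
    have hny := n3 y hy hlt
    rw [← hP x hx _ n1 y hy n2.le hny]
    have hsub : X.filter (fun c => nxt X x ≤ c ∧ c < y) ⊂ X.filter (fun c => x ≤ c ∧ c < y) := by
      rw [Finset.ssubset_iff_of_subset]
      · refine ⟨x, by simp [hx, hlt], ?_⟩
        simp only [Finset.mem_filter, not_and]
        intro _ h; linarith
      · intro c hc
        simp only [Finset.mem_filter] at hc ⊢
        exact ⟨hc.1, n2.le.trans hc.2.1, hc.2.2⟩
    rw [ih _ n1 y hy hny (by have := Finset.card_lt_card hsub; omega)]
    rw [← Finset.sum_erase_add X (fun c => if x ≤ c ∧ c < y then P c (nxt X c) else 0) hx,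
      ← Finset.sum_erase_add X (fun c => if nxt X x ≤ c ∧ c < y then P c (nxt X c) else 0) hx]
    simp only [le_refl, hlt, and_self, if_true, not_le.2 n2, false_and, if_false, add_zero]
    rw [add_comm]
    congr 1
    apply Finset.sum_congr rfl
    intro c hc
    rw [Finset.mem_erase] at hc
    congr 1
    apply propext
    constructor
    · rintro ⟨a, b⟩; exact ⟨n2.le.trans a, b⟩
    · rintro ⟨a, b⟩; exact ⟨n3 c hc.2 (lt_of_le_of_ne a (Ne.symm hc.1)), b⟩

lemma line_main (X : Finset ℝ) (P : ℝ → ℝ → A) (h0 : ∀ x, P x x = 0)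
    (hP : ∀ x ∈ X, ∀ y ∈ X, ∀ z ∈ X, x ≤ y → y ≤ z → P x y + P y z = P x z)
    (I J : Multiset (ℝ × ℝ)) (hI : ∀ i ∈ I, i.1 ∈ X ∧ i.2 ∈ X ∧ i.1 ≤ i.2)
    (hJ : ∀ i ∈ J, i.1 ∈ X ∧ i.2 ∈ X ∧ i.1 ≤ i.2)
    (hc : ∀ h, h ∉ X → (I.map (fun i => if i.1 ≤ h ∧ h ≤ i.2 then 1 else 0)).sum =
      (J.map (fun i => if i.1 ≤ h ∧ h ≤ i.2 then 1 else 0)).sum) :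
    (I.map (fun i => P i.1 i.2)).sum = (J.map (fun i => P i.1 i.2)).sum := by
  have key : ∀ I : Multiset (ℝ × ℝ), (∀ i ∈ I, i.1 ∈ X ∧ i.2 ∈ X ∧ i.1 ≤ i.2) →
      (I.map (fun i => P i.1 i.2)).sum =
      ∑ c ∈ X, (I.map (fun i => if i.1 ≤ c ∧ c < i.2 then 1 else 0)).sum • P c (nxt X c) := by
    intro I
    induction I using Multiset.induction_on with
    | empty => simp
    | cons i I ih =>
      intro h
      obtain ⟨i1, i2, i3⟩ := h i (by simp)
      rw [Multiset.map_cons, Multiset.sum_cons, ih (fun j hj => h j (by simp [hj])),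
        line_repr X P h0 hP _ _ i1 _ i2 i3 le_rfl, ← Finset.sum_add_distrib]
      apply Finset.sum_congr rfl
      intro c _
      rw [Multiset.map_cons, Multiset.sum_cons, add_smul]
      congr 1
      split_ifs <;> simp
  rw [key I hI, key J hJ]
  apply Finset.sum_congr rfl
  intro c hcX
  congr 1
  by_cases hn : ∃ y ∈ X, c < y
  · obtain ⟨y, hy, hcy⟩ := hn
    obtain ⟨n1, n2, n3⟩ := nxt_spec X hy hcy
    have hmid : (c + nxt X c) / 2 ∉ X := by
      intro hm
      have := n3 _ hm (by linarith)
      linarith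
    have e : ∀ I : Multiset (ℝ × ℝ), (∀ i ∈ I, i.1 ∈ X ∧ i.2 ∈ X ∧ i.1 ≤ i.2) →
        (I.map (fun i => if i.1 ≤ c ∧ c < i.2 then 1 else 0)).sum =
        (I.map (fun i => if i.1 ≤ (c + nxt X c) / 2 ∧ (c + nxt X c) / 2 ≤ i.2 then 1 else 0)).sum := by
      intro I hI
      congr 1
      apply Multiset.map_congr rfl
      intro i hi
      obtain ⟨i1, i2, i3⟩ := hI i hi
      congr 1
      apply propext
      constructor
      · rintro ⟨a, b⟩
        have := n3 _ i2 b
        constructor <;> linarith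
      · rintro ⟨a, b⟩
        constructor
        · by_contra! hh
          have := n3 _ i1 hh
          linarith
        · linarith
    rw [e I hI, e J hJ, hc _ hmid]
  · push Not at hn
    have e : ∀ I : Multiset (ℝ × ℝ), (∀ i ∈ I, i.1 ∈ X ∧ i.2 ∈ X ∧ i.1 ≤ i.2) →
        (I.map (fun i => if i.1 ≤ c ∧ c < i.2 then 1 else 0)).sum = 0 := by
      intro I hI
      apply Multiset.sum_eq_zero
      intro z hz
      obtain ⟨i, hi, rfl⟩ := Multiset.mem_map.1 hz
      rw [if_neg]
      rintro ⟨a, b⟩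
      have := hn _ (hI i hi).2.1
      linarith
    rw [e I hI, e J hJ]

lemma exists_nondeg (V : Type*) [NormedAddCommGroup V] [NormedSpace ℝ V] [FiniteDimensional ℝ V] :
    ∃ M : Multiset V, Nondeg M := by
  have : Nonempty (AffineBasis (Fin (Module.finrank ℝ V + 1)) ℝ V) :=
    AffineBasis.exists_affineBasis_of_finiteDimensional (by simp)
  obtain ⟨b⟩ := this
  exact ⟨_, basis_nondeg b⟩

lemma nondeg_map {M : Multiset V} (h : Nondeg M) {V' : Type*} [NormedAddCommGroup V']
    [NormedSpace ℝ V'] [FiniteDimensional ℝ V'] (φ : V ≃ᵃ[ℝ] V') : Nondeg (M.map φ) := by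
  refine ⟨?_, ?_⟩
  · rw [Multiset.card_map, h.1, φ.linear.finrank_eq]
  · have := congrArg (AffineSubspace.map φ.toAffineMap) h.2
    rw [AffineSubspace.map_span, AffineMap.map_top_of_surjective _ φ.surjective] at this
    rw [← this]
    congr 1
    ext z
    simp only [vs, mem_image]
    exact Multiset.mem_map

lemma hull_map (M : Multiset V) {V' : Type*} [NormedAddCommGroup V']
    [NormedSpace ℝ V'] (φ : V →ᵃ[ℝ] V') : hull (M.map φ) = φ '' hull M := by
  rw [hull, hull, AffineMap.image_convexHull]
  congr 1
  ext z
  exact Multiset.mem_map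

lemma exists_big (S : Finset W) : ∃ B : Multiset W, Nondeg B ∧ ∀ x ∈ S, x ∈ hull B := by
  obtain ⟨M, hM⟩ := exists_nondeg W
  have hinter : (interior (hull M)).Nonempty := by
    rw [hull, interior_convexHull_nonempty_iff_affineSpan_eq_top]
    exact hM.2
  obtain ⟨p, hp⟩ := hinter
  have hev : ∀ x ∈ S, ∀ᶠ ε in nhdsWithin (0:ℝ) (Ioi 0), AffineMap.homothety p ε x ∈ hull M := by
    intro x _
    have hcont : Continuous (fun ε : ℝ => AffineMap.homothety p ε x) := by
      simp only [AffineMap.homothety_apply, vsub_eq_sub, vadd_eq_add]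
      fun_prop
    have ht : Filter.Tendsto (fun ε : ℝ => AffineMap.homothety p ε x) (nhds 0) (nhds p) := by
      have := hcont.tendsto 0
      simpa using this
    have := ht.eventually (mem_interior_iff_mem_nhds.1 hp)
    exact this.filter_mono nhdsWithin_le_nhds
  rw [← Filter.eventually_all_finset] at hev
  obtain ⟨ε, h1, h2⟩ := (hev.and self_mem_nhdsWithin).exists
  have hε : ε ≠ 0 := (ne_of_gt h2)
  let φ : W ≃ᵃ[ℝ] W := AffineEquiv.homothetyUnitsMulHom p (Units.mk0 ε hε)
  have hφ : ∀ x, φ x = AffineMap.homothety p ε x := fun x => rfl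
  refine ⟨M.map φ.symm, nondeg_map hM φ.symm, ?_⟩
  intro x hx
  have := hull_map M φ.symm.toAffineMap
  simp only [AffineEquiv.coe_toAffineMap] at this
  rw [this]
  refine ⟨φ x, ?_, by simp⟩
  rw [hφ]; exact h1 x hx

lemma signs {e : Multiset W} {p : W} (hp : p ∈ hull e)
    (hc : ∀ f : W →ᵃ[ℝ] ℝ, (∀ x ∈ e, 0 ≤ f x) → f p = 0 → f = 0) {f : W →ᵃ[ℝ] ℝ}
    (hs : SignConst f e) :
    (f p = 0 → f = 0) ∧ (0 ≤ f p → ∀ x ∈ e, 0 ≤ f x) ∧ (f p ≤ 0 → ∀ x ∈ e, f x ≤ 0) := by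
  have h0 : f p = 0 → f = 0 := by
    intro h
    rcases hs with hs | hs
    · have := hc (-f) (fun x hx => by simpa using hs x hx) (by simpa using h)
      simpa using this
    · exact hc f hs h
  refine ⟨h0, ?_, ?_⟩
  · intro h
    rcases hs with hs | hs
    · have : f = 0 := h0 (le_antisymm (hull_nonpos f e hs p hp) h)
      simp [this]
    · exact hs
  · intro h
    rcases hs with hs | hs
    · exact hs
    · have : f = 0 := h0 (le_antisymm h (hull_nonneg f e hs p hp))
      simp [this]

lemma ev_sign {X : Type*} [TopologicalSpace X] {g : X → ℝ} (hg : Continuous g) {a : X}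
    (h : g a ≠ 0) : ∀ᶠ q in nhds a, (0 ≤ g q ↔ 0 ≤ g a) := by
  rcases lt_or_gt_of_ne h with h | h
  · filter_upwards [hg.continuousAt.eventually (gt_mem_nhds h)] with q hq
    exact ⟨fun h' => absurd hq (not_lt.2 h'), fun h' => absurd h (not_lt.2 h')⟩
  · filter_upwards [hg.continuousAt.eventually (lt_mem_nhds h)] with q hq
    exact ⟨fun _ => h.le, fun _ => hq.le⟩

lemma withTop_sum (E : Multiset (Multiset W)) (g : Multiset W → A) :
    ((E.map (fun e => (g e : WithTop A))).sum) = (((E.map g).sum : A) : WithTop A) := by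
  induction E using Multiset.induction_on with
  | empty => simp
  | cons e E ih => simp [ih]

lemma sum_filter_ite (E : Multiset (Multiset W)) (p : Multiset W → Prop) (g : Multiset W → A) :
    ((E.filter p).map g).sum = (E.map (fun e => if p e then g e else 0)).sum := by
  induction E using Multiset.induction_on with
  | empty => simp
  | cons e E ih =>
    by_cases h : p e
    · simp [h, ih]
    · simp [h, ih]

end P5
end Star

namespace Star
set_option linter.unusedSectionVars false

section P6
variable {W : Type*} [NormedAddCommGroup W] [NormedSpace ℝ W] [FiniteDimensional ℝ W]
variable {A : Type} [AddCommMonoid A]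
variable {Φ : Multiset (W × ℝ) → A}

/-- decomposition of a prism over a common refinement -/
lemma prism_decomp (hQ : MainQ W) (hΦ : IsAdd Φ) {D : Col W} (hD : D.Good)
    {B : Multiset W} {E : Multiset (Multiset W)} (hE : Sub B E) (hB : hull D.base ⊆ hull B)
    (hs : Finset (W →ᵃ[ℝ] ℝ)) (hs0 : ∀ f ∈ hs, f ≠ 0)
    (hs1 : ∀ x, x ∈ hull D.base ↔ ∀ f ∈ hs, 0 ≤ f x)
    (hN : ∀ e ∈ E, Nondeg e) (hsign : ∀ e ∈ E, ∀ f ∈ hs, SignConst f e)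
    (cen : Multiset W → W) (hcen : ∀ e ∈ E, cen e ∈ hull e ∧
      ∀ f : W →ᵃ[ℝ] ℝ, (∀ x ∈ e, 0 ≤ f x) → f (cen e) = 0 → f = 0) :
    prism Φ D.s D.t D.base =
      (E.map (fun e => if cen e ∈ hull D.base then prism Φ D.s D.t e else 0)).sum := by
  have hsub : ∀ e ∈ E, cen e ∈ hull D.base → hull e ⊆ hull D.base := by
    intro e he hce z hz
    rw [hs1] at hce ⊢
    intro f hf
    obtain ⟨_, h2, _⟩ := signs (hcen e he).1 (hcen e he).2 (hsign e he f hf)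
    exact hull_nonneg f e (h2 (hce f hf)) z hz
  have hcount : ∀ᶠ z in gen W, cnt {D.base} z = cnt (E.filter (fun e => cen e ∈ hull D.base)) z := by
    have hgen : ∀ᶠ z in gen W, ∀ f ∈ hs, f z ≠ 0 := by
      rw [Filter.eventually_all_finset]
      intro f hf
      exact gen_ne f (hs0 f hf)
    filter_upwards [hgen, hE.count] with z hz hcz
    have h1 : ∀ e ∈ E, z ∈ hull e → (cen e ∈ hull D.base ↔ z ∈ hull D.base) := by
      intro e he hze
      constructor
      · intro h; exact hsub e he h hze
      · intro h
        rw [hs1] at h ⊢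
        intro f hf
        obtain ⟨_, _, h3⟩ := signs (hcen e he).1 (hcen e he).2 (hsign e he f hf)
        by_contra hn
        have := hull_nonpos f e (h3 (not_le.1 hn).le) z hze
        exact hz f hf (le_antisymm this (h f hf))
    have h2 : cnt (E.filter (fun e => cen e ∈ hull D.base)) z =
        if z ∈ hull D.base then cnt E z else 0 := by
      rw [cnt, sum_filter_ite]
      split_ifs with hzD
      · rw [cnt]
        congr 1
        apply Multiset.map_congr rfl
        intro e he
        by_cases hze : z ∈ hull e
        · simp [hze, (h1 e he hze).2 hzD]
        · simp [hze]
      · apply Multiset.sum_eq_zero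
        intro k hk
        obtain ⟨e, he, rfl⟩ := Multiset.mem_map.1 hk
        by_cases hze : z ∈ hull e
        · have hne : cen e ∉ hull D.base := fun h => hzD ((h1 e he hze).1 h)
          simp [hne]
        · simp [hze]
    rw [h2, ← hcz]
    by_cases hzD : z ∈ hull D.base
    · simp [cnt, hzD, hB hzD]
    · simp [cnt, hzD]
  have := hQ (WithTop A) (Psi Φ D.s D.t) (Psi_isAdd hΦ _ _) _ _ (by simpa using hD.1)
    (fun e he => hN e (Multiset.mem_of_mem_filter he)) hcount
  rw [Multiset.map_singleton, Multiset.sum_singleton, Psi_good _ _ _ hD.2] at this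
  have e2 : (E.filter (fun e => cen e ∈ hull D.base)).map (Psi Φ D.s D.t) =
      (E.filter (fun e => cen e ∈ hull D.base)).map (fun e => ((prism Φ D.s D.t e : A) : WithTop A)) := by
    apply Multiset.map_congr rfl
    intro e he
    rw [Multiset.mem_filter] at he
    apply Psi_good
    intro w hw
    have := hull_nonneg (D.t - D.s) D.base (fun x hx => by simpa using hD.2 x hx) w
      (hsub e he.1 he.2 (mem_hull hw))
    simpa using this
  rw [e2, withTop_sum, WithTop.coe_inj] at this
  rw [this, sum_filter_ite]

lemma col_main (hQ : MainQ W) (hΦ : IsAdd Φ) (C C' : Multiset (Col W)) (hC : ∀ D ∈ C, D.Good)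
    (hC' : ∀ D ∈ C', D.Good) (hcnt : ∀ᶠ x in gen (W × ℝ), ccnt C x = ccnt C' x) :
    (C.map (fun D => prism Φ D.s D.t D.base)).sum =
      (C'.map (fun D => prism Φ D.s D.t D.base)).sum := by
  have hex : ∀ σ : Multiset W, ∃ hs : Finset (W →ᵃ[ℝ] ℝ), Nondeg σ → (∀ f ∈ hs, f ≠ 0) ∧
      ∀ x, x ∈ hull σ ↔ ∀ f ∈ hs, 0 ≤ f x := by
    intro σ
    by_cases h : Nondeg σ
    · obtain ⟨hs, h'⟩ := nondeg_halfspaces h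
      exact ⟨hs, fun _ => h'⟩
    · exact ⟨∅, fun h' => absurd h' h⟩
  choose hs hhs using hex
  have hex2 : ∀ e : Multiset W, ∃ p, Nondeg e → p ∈ hull e ∧
      ∀ f : W →ᵃ[ℝ] ℝ, (∀ x ∈ e, 0 ≤ f x) → f p = 0 → f = 0 := by
    intro e
    by_cases h : Nondeg e
    · obtain ⟨p, h1, h2⟩ := nondeg_center h
      exact ⟨p, fun _ => ⟨h1, h2⟩⟩
    · exact ⟨0, fun h' => absurd h' h⟩
  choose cen hcen using hex2
  let CC : Finset (Col W) := (C + C').toFinset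
  have hCC : ∀ D ∈ CC, D.Good := by
    intro D hD
    simp only [CC, Multiset.mem_toFinset, Multiset.mem_add] at hD
    rcases hD with h | h
    · exact hC D h
    · exact hC' D h
  let U : Finset (W →ᵃ[ℝ] ℝ) := CC.image Col.s ∪ CC.image Col.t
  have hU1 : ∀ D ∈ CC, D.s ∈ U := fun D hD =>
    Finset.mem_union_left _ (Finset.mem_image_of_mem _ hD)
  have hU2 : ∀ D ∈ CC, D.t ∈ U := fun D hD =>
    Finset.mem_union_right _ (Finset.mem_image_of_mem _ hD)
  let fs : Finset (W →ᵃ[ℝ] ℝ) := CC.biUnion (fun D => hs D.base) ∪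
    (U ×ˢ U).image (fun u => u.1 - u.2)
  have hfs1 : ∀ D ∈ CC, ∀ f ∈ hs D.base, f ∈ fs := fun D hD f hf =>
    Finset.mem_union_left _ (Finset.mem_biUnion.2 ⟨D, hD, hf⟩)
  have hfs2 : ∀ u ∈ U, ∀ v ∈ U, u - v ∈ fs := fun u hu v hv =>
    Finset.mem_union_right _ (Finset.mem_image.2 ⟨(u, v), Finset.mem_product.2 ⟨hu, hv⟩, rfl⟩)
  obtain ⟨B, hBN, hB⟩ := exists_big (CC.biUnion (fun D => D.base.toFinset))
  have hB' : ∀ D ∈ CC, hull D.base ⊆ hull B := by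
    intro D hD
    apply hull_mono
    intro x hx
    apply hB
    rw [Finset.mem_biUnion]
    exact ⟨D, hD, Multiset.mem_toFinset.2 hx⟩
  obtain ⟨E, hE, hE2⟩ := cut_halves fs B hBN.1
  have dec : ∀ C1 : Multiset (Col W), (∀ D ∈ C1, D ∈ CC) →
      (C1.map (fun D => prism Φ D.s D.t D.base)).sum =
      (E.map (fun e => (C1.map (fun D =>
        if cen e ∈ hull D.base then prism Φ D.s D.t e else 0)).sum)).sum := by
    intro C1 h1
    rw [← Multiset.sum_map_sum_map]
    congr 1
    apply Multiset.map_congr rfl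
    intro D hD
    have hD' := h1 D hD
    exact prism_decomp hQ hΦ (hCC D hD') hE (hB' D hD') (hs D.base) (hhs _ (hCC D hD').1).1
      (hhs _ (hCC D hD').1).2 (fun e he => (hE2 e he).1)
      (fun e he f hf => (hE2 e he).2 f (hfs1 D hD' f hf)) cen
      (fun e he => hcen e (hE2 e he).1)
  have hmC : ∀ D ∈ C, D ∈ CC := fun D hD => by simp [CC, hD]
  have hmC' : ∀ D ∈ C', D ∈ CC := fun D hD => by simp [CC, hD]
  rw [dec C hmC, dec C' hmC']
  congr 1
  apply Multiset.map_congr rfl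
  intro e he
  obtain ⟨hp, hpc⟩ := hcen e (hE2 e he).1
  have hsg : ∀ f ∈ fs, _ := fun f hf => signs hp hpc ((hE2 e he).2 f hf)
  set p := cen e
  -- representatives
  have hex3 : ∀ x : ℝ, ∃ u : W →ᵃ[ℝ] ℝ, x ∈ U.image (fun u => u p) → u ∈ U ∧ u p = x := by
    intro x
    by_cases h : x ∈ U.image (fun u => u p)
    · obtain ⟨u, hu, h'⟩ := Finset.mem_image.1 h
      exact ⟨u, fun _ => ⟨hu, h'⟩⟩
    · exact ⟨0, fun h' => absurd h' h⟩
  choose rep hrep using hex3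
  have hUX : ∀ u ∈ U, u p ∈ U.image (fun u => u p) := fun u hu => Finset.mem_image_of_mem _ hu
  have hrepU : ∀ u ∈ U, rep (u p) = u := by
    intro u hu
    obtain ⟨h1, h2⟩ := hrep (u p) (hUX u hu)
    have := (hsg _ (hfs2 _ h1 u hu)).1 (by simp [h2])
    exact sub_eq_zero.1 this
  have hle : ∀ u ∈ U, ∀ v ∈ U, u p ≤ v p → ∀ w ∈ e, u w ≤ v w := by
    intro u hu v hv huv w hw
    have := (hsg _ (hfs2 v hv u hu)).2.1 (by simpa using huv) w hw
    simpa using this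
  have hterm : ∀ C1 : Multiset (Col W), (∀ D ∈ C1, D ∈ CC) →
      (C1.map (fun D => if p ∈ hull D.base then prism Φ D.s D.t e else 0)).sum =
      (((C1.filter (fun D => p ∈ hull D.base)).map (fun D => (D.s p, D.t p))).map
        (fun i => prism Φ (rep i.1) (rep i.2) e)).sum := by
    intro C1
    induction C1 using Multiset.induction_on with
    | empty => simp
    | cons D C1 ih =>
      intro h
      have hD : D ∈ CC := h D (by simp)
      have ih := ih (fun D' h' => h D' (by simp [h']))
      by_cases hpD : p ∈ hull D.base
      · rw [Multiset.filter_cons_of_pos (p := fun D : Col W => p ∈ hull D.base) _ hpD, Multiset.map_cons, Multiset.sum_cons, ih]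
        simp only [Multiset.map_cons, Multiset.sum_cons, hpD, if_true]
        rw [hrepU _ (hU1 D hD), hrepU _ (hU2 D hD)]
      · rw [Multiset.filter_cons_of_neg (p := fun D : Col W => p ∈ hull D.base) _ hpD, Multiset.map_cons, Multiset.sum_cons, ih]
        simp [hpD]
  rw [hterm C hmC, hterm C' hmC']
  have hI : ∀ C1 : Multiset (Col W), (∀ D ∈ C1, D ∈ CC) →
      ∀ i ∈ (C1.filter (fun D => p ∈ hull D.base)).map (fun D => (D.s p, D.t p)),
        i.1 ∈ U.image (fun u => u p) ∧ i.2 ∈ U.image (fun u => u p) ∧ i.1 ≤ i.2 := by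
    intro C1 h i hi
    obtain ⟨D, hD, rfl⟩ := Multiset.mem_map.1 hi
    rw [Multiset.mem_filter] at hD
    have hD' := h D hD.1
    refine ⟨hUX _ (hU1 D hD'), hUX _ (hU2 D hD'), ?_⟩
    have := hull_nonneg (D.t - D.s) D.base (fun x hx => by simpa using (hCC D hD').2 x hx) p hD.2
    simpa using this
  apply line_main (U.image (fun u => u p)) (fun x y => prism Φ (rep x) (rep y) e)
  · intro x
    apply pr_flat hΦ
    intro q hq
    obtain ⟨w, hw, rfl⟩ := List.mem_map.1 hq
    rfl
  · intro x hx y hy z hz hxy hyz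
    obtain ⟨x1, x2⟩ := hrep x hx
    obtain ⟨y1, y2⟩ := hrep y hy
    obtain ⟨z1, z2⟩ := hrep z hz
    apply pr_trans hΦ
    · intro w hw
      exact hle _ x1 _ y1 (by rw [x2, y2]; exact hxy) w (Multiset.mem_toList.1 hw)
    · intro w hw
      exact hle _ y1 _ z1 (by rw [z2, y2]; exact hyz) w (Multiset.mem_toList.1 hw)
  · exact hI C hmC
  · exact hI C' hmC'
  · intro h hh
    have hcc : ∀ C1 : Multiset (Col W),
        (((C1.filter (fun D => p ∈ hull D.base)).map (fun D => (D.s p, D.t p))).map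
          (fun i => if i.1 ≤ h ∧ h ≤ i.2 then 1 else 0)).sum = ccnt C1 (p, h) := by
      intro C1
      induction C1 using Multiset.induction_on with
      | empty => simp [ccnt]
      | cons D C1 ih =>
        have e1 : ccnt (D ::ₘ C1) (p, h) = (if (p, h) ∈ D.reg then 1 else 0) + ccnt C1 (p, h) := by
          simp [ccnt]
        rw [e1, ← ih]
        by_cases hpD : p ∈ hull D.base
        · rw [Multiset.filter_cons_of_pos (p := fun D : Col W => p ∈ hull D.base) _ hpD]
          simp [Col.reg, hpD]
        · rw [Multiset.filter_cons_of_neg (p := fun D : Col W => p ∈ hull D.base) _ hpD]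
          simp [Col.reg, hpD]
    rw [hcc, hcc]
    -- local constancy
    have hloc : ∀ D ∈ CC, ∀ᶠ q in nhds (p, h), (q ∈ D.reg ↔ (p, h) ∈ D.reg) := by
      intro D hD
      have a1 : ∀ᶠ q : W × ℝ in nhds (p, h), ∀ f ∈ hs D.base, (0 ≤ f q.1 ↔ 0 ≤ f p) := by
        rw [Filter.eventually_all_finset]
        intro f hf
        have hfc : Continuous f := f.continuous_of_finiteDimensional
        have hf0 : f p ≠ 0 := fun h0 =>
          (hhs _ (hCC D hD).1).1 f hf ((hsg f (hfs1 D hD f hf)).1 h0)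
        exact ev_sign (g := fun q : W × ℝ => f q.1) (hfc.comp continuous_fst) (a := (p, h)) hf0
      have hsc : Continuous D.s := D.s.continuous_of_finiteDimensional
      have htc : Continuous D.t := D.t.continuous_of_finiteDimensional
      have a2 := ev_sign (g := fun q : W × ℝ => q.2 - D.s q.1) (by fun_prop) (a := (p, h))
        (fun h0 => hh (by
          have : h = D.s p := sub_eq_zero.1 h0
          rw [this]; exact hUX _ (hU1 D hD)))
      have a3 := ev_sign (g := fun q : W × ℝ => D.t q.1 - q.2) (by fun_prop) (a := (p, h))
        (fun h0 => hh (by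
          have : D.t p = h := sub_eq_zero.1 h0
          rw [← this]; exact hUX _ (hU2 D hD)))
      filter_upwards [a1, a2, a3] with q q1 q2 q3
      simp only [sub_nonneg] at q2 q3
      show (q.1 ∈ hull D.base ∧ _) ↔ (p ∈ hull D.base ∧ _)
      rw [(hhs _ (hCC D hD).1).2, (hhs _ (hCC D hD).1).2, q2, q3]
      have : (∀ f ∈ hs D.base, 0 ≤ f q.1) ↔ (∀ f ∈ hs D.base, 0 ≤ f p) :=
        forall₂_congr q1
      rw [this]
    rw [← Filter.eventually_all_finset] at hloc
    obtain ⟨q, hq1, hq2⟩ := (gen_dense hcnt).inter_nhds_nonempty hloc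
    have hcl : ∀ C1 : Multiset (Col W), (∀ D ∈ C1, D ∈ CC) → ccnt C1 (p, h) = ccnt C1 q := by
      intro C1 h1
      rw [ccnt, ccnt]
      congr 1
      apply Multiset.map_congr rfl
      intro D hD
      have : q ∈ D.reg ↔ (p, h) ∈ D.reg := hq2 D (h1 D hD)
      simp only [this]
    rw [hcl C hmC, hcl C' hmC']
    exact hq1

lemma mainQ_succ (hQ : MainQ W) : MainQ (W × ℝ) := by
  intro A _ Φ hΦ F G hF hG hcnt
  obtain ⟨C, c1, c2, c3⟩ := exists_cols F hF
  obtain ⟨C', d1, d2, d3⟩ := exists_cols G hG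
  rw [c3 A Φ hΦ, d3 A Φ hΦ]
  apply col_main hQ hΦ C C' c1 d1
  filter_upwards [hcnt, c2, d2] with x h1 h2 h3
  rw [← h2, ← h3, h1]

end P6
end Star

namespace Star
set_option linter.unusedSectionVars false

section P7

lemma mainQ_transport {V V' : Type} [NormedAddCommGroup V] [NormedSpace ℝ V] [FiniteDimensional ℝ V]
    [NormedAddCommGroup V'] [NormedSpace ℝ V'] [FiniteDimensional ℝ V']
    (e : V ≃ₗ[ℝ] V') (h : MainQ V') : MainQ V := by
  intro A _ Φ hΦ F G hF hG hc
  have hback : ∀ M : Multiset V, (M.map e).map e.symm = M := by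
    intro M
    rw [Multiset.map_map]
    simp
  have hback' : ∀ M : Multiset V', (M.map e.symm).map e = M := by
    intro M
    rw [Multiset.map_map]
    simp
  have ht : Filter.Tendsto e.symm (gen V') (gen V) := by
    unfold gen
    rw [Filter.tendsto_iInf]
    intro f
    rw [Filter.tendsto_principal]
    refine gen_ne (f.1.comp e.symm.toLinearMap.toAffineMap) ?_
    intro h0
    apply f.2
    ext x
    have := congrArg (fun g => g (e x)) h0
    simpa using this
  have hcnt : ∀ (F : Multiset (Multiset V)) (x : V'),
      cnt (F.map (fun M => M.map e)) x = cnt F (e.symm x) := by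
    intro F x
    rw [cnt, cnt, Multiset.map_map]
    congr 1
    apply Multiset.map_congr rfl
    intro M hM
    have hh : hull (M.map e) = e '' hull M := hull_map M e.toLinearMap.toAffineMap
    have : x ∈ hull (M.map e) ↔ e.symm x ∈ hull M := by
      rw [hh]
      constructor
      · rintro ⟨y, hy, rfl⟩; simpa using hy
      · intro hy; exact ⟨_, hy, by simp⟩
    simp only [Function.comp, this]
  have key := h A (fun M => Φ (M.map e.symm)) ⟨?_, ?_⟩ (F.map (fun M => M.map e))
    (G.map (fun M => M.map e)) ?_ ?_ ?_
  · rw [Multiset.map_map, Multiset.map_map] at key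
    simpa only [Function.comp, hback] using key
  · intro M hM
    apply hΦ.deg
    intro hN
    apply hM
    have := nondeg_map hN e.toAffineEquiv
    rw [← hback' M]
    exact this
  · intro x y m R hm
    simp only [Multiset.map_cons]
    apply hΦ.cut
    have := mem_image_of_mem e.symm.toLinearMap.toAffineMap hm
    rw [image_segment] at this
    exact this
  · intro M hM
    obtain ⟨M, hM', rfl⟩ := Multiset.mem_map.1 hM
    exact nondeg_map (hF M hM') e.toAffineEquiv
  · intro M hM
    obtain ⟨M, hM', rfl⟩ := Multiset.mem_map.1 hM
    exact nondeg_map (hG M hM') e.toAffineEquiv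
  · filter_upwards [ht.eventually hc] with x hx
    rw [hcnt, hcnt, hx]

lemma mainQ_zero {V : Type} [NormedAddCommGroup V] [NormedSpace ℝ V] [FiniteDimensional ℝ V]
    (h : Module.finrank ℝ V = 0) : MainQ V := by
  intro A _ Φ hΦ F G hF hG hc
  have hs : Subsingleton V := Module.finrank_zero_iff.1 h
  have h0 : ∀ M : Multiset V, Nondeg M → M = {0} := by
    intro M hM
    have := hM.1
    rw [h] at this
    obtain ⟨x, rfl⟩ := Multiset.card_eq_one.1 this
    rw [Subsingleton.elim x 0]
  have hr : ∀ F : Multiset (Multiset V), (∀ M ∈ F, Nondeg M) →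
      F = Multiset.replicate (Multiset.card F) {0} := by
    intro F hF
    rw [Multiset.eq_replicate]
    exact ⟨rfl, fun M hM => h0 M (hF M hM)⟩
  obtain ⟨x, hx⟩ := (gen_dense hc).nonempty
  have hh : x ∈ hull ({0} : Multiset V) := by
    rw [Subsingleton.elim x 0]
    exact mem_hull (by simp)
  have hk : ∀ F : Multiset (Multiset V), (∀ M ∈ F, Nondeg M) → cnt F x = Multiset.card F := by
    intro F hF
    rw [hr F hF]
    simp [cnt, hh]
  have hx : cnt F x = cnt G x := hx
  rw [hk F hF, hk G hG] at hx
  rw [hr F hF, hr G hG, hx]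

theorem mainQ_all : ∀ (n : ℕ) (V : Type) [NormedAddCommGroup V] [NormedSpace ℝ V]
    [FiniteDimensional ℝ V], Module.finrank ℝ V = n → MainQ V := by
  intro n
  induction n with
  | zero => intro V _ _ _ h; exact mainQ_zero h
  | succ n ih =>
    intro V _ _ _ h
    have e : V ≃ₗ[ℝ] EuclideanSpace ℝ (Fin n) × ℝ :=
      LinearEquiv.ofFinrankEq _ _ (by simp [h])
    exact mainQ_transport e (mainQ_succ (ih _ (by simp)))

end P7
end Star

namespace Star
set_option linter.unusedSectionVars false

section P8
variable {V : Type} [NormedAddCommGroup V] [NormedSpace ℝ V] [FiniteDimensional ℝ V]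
variable {N : ℕ} {φ : V →ᵃ[ℝ] Euc N} {ψ : Euc N →ᵃ[ℝ] V}

lemma nondeg_exists {M : Multiset V} (h : Nondeg M) {p : V → Prop} (hp : ∀ᶠ x in gen V, p x) :
    ∃ x ∈ hull M, p x := by
  have hi : (interior (hull M)).Nonempty := by
    unfold hull
    rw [interior_convexHull_nonempty_iff_affineSpan_eq_top]
    exact h.2
  obtain ⟨x, hx, hx'⟩ := (gen_dense hp).exists_mem_open isOpen_interior hi
  exact ⟨x, interior_subset hx', hx⟩

lemma simplex_of_nondeg (hφ : Function.Injective φ) {M : Multiset V} (h : Nondeg M) :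
    ∃ b : AffineBasis (Fin (Module.finrank ℝ V + 1)) ℝ V, M = Finset.univ.val.map b ∧
      AffineIndependent ℝ (φ ∘ b) ∧ φ '' hull M = convexHull ℝ (range (φ ∘ b)) := by
  obtain ⟨b, rfl⟩ := nondeg_basis h
  refine ⟨b, rfl, b.ind.map' φ hφ, ?_⟩
  rw [hull, vs_basis, AffineMap.image_convexHull, range_comp]

lemma isSimplex_of_nondeg (hφ : Function.Injective φ) {M : Multiset V} (h : Nondeg M) :
    IsSimplex (Module.finrank ℝ V) (φ '' hull M) := by
  obtain ⟨b, _, h1, h2⟩ := simplex_of_nondeg hφ h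
  exact ⟨_, h1, h2⟩

lemma nondeg_of_isSimplex (hψ : ∀ x, ψ (φ x) = x) {S : Set (Euc N)}
    (h : IsSimplex (Module.finrank ℝ V) S) (hS : S ⊆ range φ) :
    ∃ M : Multiset V, Nondeg M ∧ φ '' hull M = S := by
  obtain ⟨w, hw, rfl⟩ := h
  have hr : ∀ i, φ (ψ (w i)) = w i := by
    intro i
    obtain ⟨x, hx⟩ := hS (subset_convexHull ℝ _ (mem_range_self i))
    rw [← hx, hψ]
  have hc : φ ∘ (ψ ∘ w) = w := by ext1 i; exact hr i
  have hu : AffineIndependent ℝ (ψ ∘ w) := by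
    apply AffineIndependent.of_comp φ
    rw [hc]; exact hw
  have hv : vs ((Finset.univ : Finset (Fin (Module.finrank ℝ V + 1))).val.map (ψ ∘ w)) =
      range (ψ ∘ w) := by
    ext x; exact mem_map_univ (ψ ∘ w) x
  refine ⟨(Finset.univ : Finset (Fin (Module.finrank ℝ V + 1))).val.map (ψ ∘ w), ⟨by simp, ?_⟩, ?_⟩
  · rw [hv, hu.affineSpan_eq_top_iff_card_eq_finrank_add_one]
    simp
  · rw [hull, hv, AffineMap.image_convexHull, ← range_comp, hc]

lemma hull_half {x y m : V} {R : Multiset V} (hM : Nondeg (x ::ₘ y ::ₘ R))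
    (hm : m ∈ segment ℝ x y) (hy : m ≠ y) (g : V →ᵃ[ℝ] ℝ) (hg : g ≠ 0)
    (gm : g m = 0) (gR : ∀ r ∈ R, g r = 0) (gx : g x ≤ 0) (gy : 0 ≤ g y) :
    hull (x ::ₘ m ::ₘ R) = hull (x ::ₘ y ::ₘ R) ∩ {z | g z ≤ 0} := by
  apply subset_antisymm
  · refine subset_inter (hull_cut_left R hm) ?_
    refine fun z hz => hull_nonpos g _ ?_ z hz
    intro w hw
    simp only [Multiset.mem_cons] at hw
    rcases hw with rfl | rfl | hw
    · exact gx
    · exact gm.le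
    · exact (gR w hw).le
  · rintro z ⟨hz, hz0⟩
    have hz0 : g z ≤ 0 := hz0
    rw [hull_cut R hm] at hz
    rcases hz with hz | hz
    · exact hz
    have gy' : g y ≠ 0 := by
      intro h0
      apply hg
      refine nondeg_ext hM g 0 ?_
      obtain ⟨a, b, ha, hb, hab, he, hh⟩ := affine_seg g hm
      have ha' : a ≠ 0 := by
        rintro rfl
        have hb1 : b = 1 := by linarith
        subst hb1
        simp at he
        exact hy he.symm
      intro w hw
      simp only [Multiset.mem_cons] at hw
      rcases hw with rfl | rfl | hw
      · rw [gm, h0] at hh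
        simpa [ha'] using hh
      · exact h0
      · exact gR w hw
    rw [Multiset.cons_swap, hull, vs_cons, convexHull_insert ⟨m, by simp⟩] at hz
    simp only [convexJoin_singleton_left, mem_iUnion] at hz
    obtain ⟨w, hw, hzw⟩ := hz
    have gw : g w = 0 := by
      have h1 : ∀ u ∈ m ::ₘ R, g u = 0 := by
        intro u hu
        simp only [Multiset.mem_cons] at hu
        rcases hu with rfl | hu
        · exact gm
        · exact gR u hu
      exact le_antisymm (hull_nonpos g _ (fun u hu => (h1 u hu).le) w hw)
        (hull_nonneg g _ (fun u hu => (h1 u hu).ge) w hw)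
    obtain ⟨a, b, ha, hb, hab, he, hh⟩ := affine_seg g hzw
    have ha0 : a = 0 := by
      rw [gw] at hh
      have gyp : 0 < g y := lt_of_le_of_ne gy (Ne.symm gy')
      by_contra hne
      have : 0 < a := lt_of_le_of_ne ha (Ne.symm hne)
      nlinarith [mul_pos this gyp]
    subst ha0
    have hb1 : b = 1 := by linarith
    subst hb1
    simp at he
    subst he
    refine hull_mono ?_ hw
    intro u hu
    exact mem_hull (Multiset.mem_cons_of_mem hu)

lemma segment_swap_half {x y m : V} {R : Multiset V} (hM : Nondeg (x ::ₘ y ::ₘ R))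
    (hm : m ∈ segment ℝ x y) (hx : m ≠ x) (g : V →ᵃ[ℝ] ℝ) (hg : g ≠ 0)
    (gm : g m = 0) (gR : ∀ r ∈ R, g r = 0) (gx : g x ≤ 0) (gy : 0 ≤ g y) :
    hull (m ::ₘ y ::ₘ R) = hull (x ::ₘ y ::ₘ R) ∩ {z | 0 ≤ g z} := by
  have := hull_half (x := y) (y := x) (m := m) (R := R) (by rwa [Multiset.cons_swap])
    (by rwa [segment_symm]) hx (-g) (by simpa using hg) (by simp [gm])
    (fun r hr => by simp [gR r hr]) (by simpa using gy) (by simpa using gx)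
  rw [Multiset.cons_swap m y, this, Multiset.cons_swap y x]
  ext z
  simp

lemma hull_ne {x y m : V} {R : Multiset V} (hM : Nondeg (x ::ₘ y ::ₘ R))
    (hm : m ∈ segment ℝ x y) (hx : m ≠ x) :
    hull (x ::ₘ m ::ₘ R) ≠ hull (m ::ₘ y ::ₘ R) := by
  intro h
  obtain ⟨z, hz, hz'⟩ := nondeg_exists (nondeg_cut_left hM hm hx) (cnt_cut R hM.1 hm)
  rw [← h, if_pos hz] at hz'
  split_ifs at hz' <;> omega

lemma dissect (hψ : ∀ x, ψ (φ x) = x) {x y m : V} {R : Multiset V} (hM : Nondeg (x ::ₘ y ::ₘ R))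
    (hm : m ∈ segment ℝ x y) (hx : m ≠ x) (hy : m ≠ y) :
    IsDissection (Module.finrank ℝ V) (φ '' hull (x ::ₘ y ::ₘ R)) (φ '' hull (x ::ₘ m ::ₘ R))
      (φ '' hull (m ::ₘ y ::ₘ R)) := by
  have hφ : Function.Injective φ := Function.LeftInverse.injective hψ
  obtain ⟨g, hg, gm, gR, gx, gy⟩ := exists_sep R hM.1.le hm hx hy
  have hf : ∀ z, (g.comp ψ).linear (φ z) = g z - (g.comp ψ) 0 := by
    intro z
    have h1 := (g.comp ψ).linearMap_vsub (φ z) 0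
    simp only [vsub_eq_sub, sub_zero] at h1
    rw [h1]
    simp [hψ]
  refine ⟨isSimplex_of_nondeg hφ (nondeg_cut_left hM hm hx),
    isSimplex_of_nondeg hφ (nondeg_cut_right hM hm hy), ?_, ?_, (g.comp ψ).linear,
    - (g.comp ψ) 0, ?_, ?_, ?_, ?_⟩
  · rw [← image_union, ← hull_cut R hm]
  · intro h
    exact hull_ne hM hm hx (hφ.image_injective h)
  · intro h0
    apply hg
    have h1 := hf m
    rw [h0, gm] at h1
    ext z
    have h2 := hf z
    rw [h0] at h2
    simp only [LinearMap.zero_apply] at h1 h2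
    simp only [AffineMap.coe_zero, Pi.zero_apply]
    linarith
  · rw [hull_half hM hm hy g hg gm gR gx gy]
    ext z
    constructor
    · rintro ⟨w, ⟨hw, hw'⟩, rfl⟩
      refine ⟨⟨w, hw, rfl⟩, ?_⟩
      show (g.comp ψ).linear (φ w) ≤ _
      have hw' : g w ≤ 0 := hw'
      rw [hf]; linarith
    · rintro ⟨⟨w, hw, rfl⟩, h⟩
      have h : (g.comp ψ).linear (φ w) ≤ - (g.comp ψ) 0 := h
      rw [hf] at h
      exact ⟨w, ⟨hw, show g w ≤ 0 by linarith⟩, rfl⟩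
  · rw [segment_swap_half hM hm hx g hg gm gR gx gy]
    ext z
    constructor
    · rintro ⟨w, ⟨hw, hw'⟩, rfl⟩
      refine ⟨⟨w, hw, rfl⟩, ?_⟩
      show _ ≤ (g.comp ψ).linear (φ w)
      have hw' : 0 ≤ g w := hw'
      rw [hf]; linarith
    · rintro ⟨⟨w, hw, rfl⟩, h⟩
      have h : - (g.comp ψ) 0 ≤ (g.comp ψ).linear (φ w) := h
      rw [hf] at h
      exact ⟨w, ⟨hw, show 0 ≤ g w by linarith⟩, rfl⟩
  · obtain ⟨b, hb, h1, h2⟩ := simplex_of_nondeg hφ hM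
    refine ⟨φ ∘ b, h1, h2, ?_⟩
    have hcard : Module.finrank ℝ V - 1 ≤ (Finset.univ.filter (fun i => g (b i) = 0)).card := by
      have e1 : (Finset.univ.filter (fun i => g (b i) = 0)).card =
          Multiset.card ((x ::ₘ y ::ₘ R).filter (fun z => g z = 0)) := by
        rw [hb, Multiset.filter_map, Multiset.card_map]
        rfl
      have e2 : R ≤ (x ::ₘ y ::ₘ R).filter (fun z => g z = 0) := by
        rw [Multiset.le_filter]
        refine ⟨(Multiset.le_cons_self _ _).trans (Multiset.le_cons_self _ _), gR⟩
      have e3 := Multiset.card_le_card e2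
      have e4 := hM.1
      simp only [Multiset.card_cons] at e4
      omega
    obtain ⟨s, hs, hs'⟩ := Finset.exists_subset_card_eq hcard
    refine ⟨s, hs', fun i hi => ?_⟩
    have := (Finset.mem_filter.1 (hs hi)).2
    simp only [Function.comp]
    rw [hf, this, zero_sub]

/-- admissible families -/
def Good (φ : V →ᵃ[ℝ] Euc N) (T : Set (Euc N)) (X : Multiset (Multiset V)) : Prop :=
  (∀ M ∈ X, Nondeg M) ∧ (∀ᶠ x in gen V, cnt X x ≤ 1) ∧
    MoveEquiv (Module.finrank ℝ V) ((X.map (fun M => φ '' hull M)).toFinset) {T}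

/-- interchangeable families -/
def goodCon (φ : V →ᵃ[ℝ] Euc N) (T : Set (Euc N)) : AddCon (Multiset (Multiset V)) where
  r X Y := ∀ Z, Good φ T (X + Z) ↔ Good φ T (Y + Z)
  iseqv := ⟨fun _ _ => Iff.rfl, fun h Z => (h Z).symm, fun h h' Z => (h Z).trans (h' Z)⟩
  add' := by
    intro w x y z h1 h2 Z
    rw [add_assoc, h1, add_left_comm, h2, add_left_comm, add_assoc]

lemma hull_notMem (hφ : Function.Injective φ) {M : Multiset V} (hM : Nondeg M)
    {Z : Multiset (Multiset V)} (hc : ∀ᶠ x in gen V, cnt (M ::ₘ Z) x ≤ 1) :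
    φ '' hull M ∉ (Z.map (fun M => φ '' hull M)).toFinset := by
  intro h
  rw [Multiset.mem_toFinset, Multiset.mem_map] at h
  obtain ⟨M', hM', he⟩ := h
  have he := hφ.image_injective he
  obtain ⟨x, hx, hx'⟩ := nondeg_exists hM hc
  obtain ⟨Z', rfl⟩ := Multiset.exists_cons_of_mem hM'
  rw [cnt_cons, cnt_cons, he, if_pos hx] at hx'
  omega

lemma good_cut (T : Set (Euc N)) (hψ : ∀ x, ψ (φ x) = x) {x y m : V} {R : Multiset V}
    (hM : Nondeg (x ::ₘ y ::ₘ R))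
    (hm : m ∈ segment ℝ x y) (hx : m ≠ x) (hy : m ≠ y) (Z : Multiset (Multiset V)) :
    Good φ T ((x ::ₘ y ::ₘ R) ::ₘ Z) ↔ Good φ T ((x ::ₘ m ::ₘ R) ::ₘ (m ::ₘ y ::ₘ R) ::ₘ Z) := by
  have hφ : Function.Injective φ := Function.LeftInverse.injective hψ
  have h1 := nondeg_cut_left hM hm hx
  have h2 := nondeg_cut_right hM hm hy
  have hcut := cnt_cut R hM.1 hm
  have hD := dissect hψ hM hm hx hy
  have hne : φ '' hull (x ::ₘ m ::ₘ R) ≠ φ '' hull (m ::ₘ y ::ₘ R) :=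
    fun h => hull_ne hM hm hx (hφ.image_injective h)
  have hU : φ '' hull (x ::ₘ m ::ₘ R) ∪ φ '' hull (m ::ₘ y ::ₘ R) = φ '' hull (x ::ₘ y ::ₘ R) := by
    rw [← image_union, ← hull_cut R hm]
  have hS := isSimplex_of_nondeg hφ hM
  have hequiv : (∀ᶠ z in gen V, cnt ((x ::ₘ y ::ₘ R) ::ₘ Z) z ≤ 1) ↔
      (∀ᶠ z in gen V, cnt ((x ::ₘ m ::ₘ R) ::ₘ (m ::ₘ y ::ₘ R) ::ₘ Z) z ≤ 1) := by
    apply Filter.eventually_congr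
    filter_upwards [hcut] with z hz
    rw [cnt_cons, cnt_cons, cnt_cons, hz, add_assoc]
  unfold Good
  rw [← hequiv]
  have hcount : (∀ᶠ z in gen V, cnt ((x ::ₘ y ::ₘ R) ::ₘ Z) z ≤ 1) →
      (ElemMove (Module.finrank ℝ V)
        ((((x ::ₘ y ::ₘ R) ::ₘ Z).map (fun M => φ '' hull M)).toFinset)
        ((((x ::ₘ m ::ₘ R) ::ₘ (m ::ₘ y ::ₘ R) ::ₘ Z).map (fun M => φ '' hull M)).toFinset)) ∧
      (ElemMove (Module.finrank ℝ V)
        ((((x ::ₘ m ::ₘ R) ::ₘ (m ::ₘ y ::ₘ R) ::ₘ Z).map (fun M => φ '' hull M)).toFinset)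
        ((((x ::ₘ y ::ₘ R) ::ₘ Z).map (fun M => φ '' hull M)).toFinset)) := by
    intro hc
    have hc2 := hequiv.1 hc
    have n0 := hull_notMem hφ hM hc
    have n1 := hull_notMem hφ h1 (Z := Z) (by
      filter_upwards [hc2] with z hz
      rw [cnt_cons] at hz ⊢
      rw [cnt_cons] at hz
      omega)
    have n2 := hull_notMem hφ h2 (Z := Z) (by
      filter_upwards [hc2] with z hz
      rw [cnt_cons] at hz
      omega)
    simp only [Multiset.map_cons, Multiset.toFinset_cons]
    generalize (Z.map (fun M => φ '' hull M)).toFinset = K at *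
    constructor
    · left
      refine ⟨_, Finset.mem_insert_self _ _, _, _, hD, ?_⟩
      rw [Finset.erase_insert n0]
    · right
      refine ⟨_, Finset.mem_insert_self _ _, _,
        Finset.mem_insert_of_mem (Finset.mem_insert_self _ _), hne, ?_, ?_⟩
      · rw [hU]; exact hS
      · rw [hU, Finset.erase_insert, Finset.erase_insert n2]
        simp only [Finset.mem_insert, not_or]
        exact ⟨hne, n1⟩
  constructor
  · rintro ⟨a1, a2, a3⟩
    refine ⟨?_, a2, Relation.ReflTransGen.head (hcount a2).2 a3⟩
    intro M hM'
    simp only [Multiset.mem_cons] at hM' a1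
    rcases hM' with rfl | rfl | hM'
    · exact h1
    · exact h2
    · exact a1 M (Or.inr hM')
  · rintro ⟨a1, a2, a3⟩
    refine ⟨?_, a2, Relation.ReflTransGen.head (hcount a2).1 a3⟩
    intro M hMem
    simp only [Multiset.mem_cons] at hMem a1
    rcases hMem with rfl | hMem
    · exact hM
    · exact a1 M (Or.inr (Or.inr hMem))

/-- universal additive function -/
def PhiU (φ : V →ᵃ[ℝ] Euc N) (T : Set (Euc N)) (M : Multiset V) : (goodCon φ T).Quotient :=
  if Nondeg M then (({M} : Multiset (Multiset V)) : (goodCon φ T).Quotient) else 0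

lemma PhiU_isAdd (T : Set (Euc N)) (hψ : ∀ x, ψ (φ x) = x) : IsAdd (PhiU φ T) := by
  constructor
  · intro M hM
    exact if_neg hM
  · intro x y m R hm
    by_cases hM : Nondeg (x ::ₘ y ::ₘ R)
    · by_cases hx : m = x
      · subst hx
        unfold PhiU
        rw [if_neg (not_nondeg_dup m R), zero_add]
      by_cases hy : m = y
      · subst hy
        unfold PhiU
        rw [if_neg (not_nondeg_dup m R), add_zero]
      rw [PhiU, PhiU, PhiU, if_pos hM, if_pos (nondeg_cut_left hM hm hx),
        if_pos (nondeg_cut_right hM hm hy), ← AddCon.coe_add, AddCon.eq]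
      intro Z
      have := good_cut T hψ hM hm hx hy Z
      rw [add_assoc, Multiset.singleton_add, Multiset.singleton_add, Multiset.singleton_add]
      exact this
    · rw [PhiU, PhiU, PhiU, if_neg hM, if_neg (fun h => hM (nondeg_of_cut_left h hm)),
        if_neg (fun h => hM (nondeg_of_cut_right h hm)), zero_add]

lemma PhiU_sum (T : Set (Euc N)) (X : Multiset (Multiset V)) (hX : ∀ M ∈ X, Nondeg M) :
    (X.map (PhiU φ T)).sum = (X : (goodCon φ T).Quotient) := by
  induction X using Multiset.induction_on with
  | empty => rfl
  | cons M X ih =>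
    rw [Multiset.map_cons, Multiset.sum_cons, ih (fun M' h => hX M' (by simp [h])), PhiU,
      if_pos (hX M (by simp)), ← AddCon.coe_add, Multiset.singleton_add]

lemma gen_inter (hφ : Function.Injective φ) {S : Set (Euc N)} (hS : sdim S < Module.finrank ℝ V) :
    ∀ᶠ x in gen V, φ x ∉ S := by
  refine gen_notMem (φ ⁻¹' S) ?_
  intro h
  have h1 : vectorSpan ℝ (φ ⁻¹' S) = ⊤ := by
    rw [← direction_affineSpan, h, AffineSubspace.direction_top]
  have h2 : (vectorSpan ℝ (φ ⁻¹' S)).map φ.linear ≤ vectorSpan ℝ S := by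
    rw [AffineMap.map_vectorSpan]
    exact vectorSpan_mono ℝ (image_preimage_subset _ _)
  rw [h1] at h2
  have h3 := Submodule.finrank_mono h2
  rw [Submodule.map_top, LinearMap.finrank_range_of_inj ((AffineMap.linear_injective_iff φ).2 hφ)] at h3
  unfold sdim at hS
  omega

theorem core (hψ : ∀ x, ψ (φ x) = x) {T : Set (Euc N)} {F : Finset (Set (Euc N))}
    (hT : IsSimplex (Module.finrank ℝ V) T) (hTr : T ⊆ range φ)
    (hF : IsTriangulation (Module.finrank ℝ V) T F) : MoveEquiv (Module.finrank ℝ V) F {T} := by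
  have hφ : Function.Injective φ := Function.LeftInverse.injective hψ
  obtain ⟨M, hM, hMT⟩ := nondeg_of_isSimplex hψ hT hTr
  have hsub : ∀ S ∈ F, S ⊆ T := by
    intro S hS
    rw [← hF.2.1]
    exact subset_biUnion_of_mem (u := fun S => S) hS
  have hex : ∀ S : Set (Euc N), ∃ M : Multiset V, S ∈ F → Nondeg M ∧ φ '' hull M = S := by
    intro S
    by_cases hS : S ∈ F
    · obtain ⟨M, hM⟩ := nondeg_of_isSimplex hψ (hF.1 S hS) ((hsub S hS).trans hTr)
      exact ⟨M, fun _ => hM⟩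
    · exact ⟨0, fun h => absurd h hS⟩
  choose mf hmf using hex
  have hX : ∀ M ∈ F.val.map mf, Nondeg M := by
    intro M hM
    obtain ⟨S, hS, rfl⟩ := Multiset.mem_map.1 hM
    exact (hmf S hS).1
  have hcnt : ∀ᶠ x in gen V, cnt (F.val.map mf) x = cnt {M} x := by
    have hpair : ∀ᶠ x in gen V, ∀ S ∈ F, ∀ S' ∈ F, S ≠ S' → φ x ∉ S ∩ S' := by
      rw [Filter.eventually_all_finset]
      intro S hS
      rw [Filter.eventually_all_finset]
      intro S' hS'
      by_cases h : S = S'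
      · simp [h]
      · filter_upwards [gen_inter hφ (hF.2.2 S hS S' hS' h)] with x hx _
        exact hx
    filter_upwards [hpair] with x hx
    have hmem : ∀ (M : Multiset V) (S : Set (Euc N)), φ '' hull M = S → (x ∈ hull M ↔ φ x ∈ S) := by
      rintro M S rfl
      exact (hφ.mem_set_image).symm
    have e1 : cnt (F.val.map mf) x = (F.filter (fun S => φ x ∈ S)).card := by
      rw [cnt, Multiset.map_map, Finset.card_filter]
      apply Finset.sum_congr rfl
      intro S hS
      simp only [Function.comp, hmem _ S (hmf S hS).2]
    have e2 : cnt {M} x = if φ x ∈ T then 1 else 0 := by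
      simp [cnt, hmem M T hMT]
    rw [e1, e2]
    split_ifs with h
    · rw [← hF.2.1] at h
      simp only [mem_iUnion] at h
      obtain ⟨S, hS, hxS⟩ := h
      rw [Finset.card_eq_one]
      refine ⟨S, ?_⟩
      ext S'
      simp only [Finset.mem_filter, Finset.mem_singleton]
      constructor
      · rintro ⟨h1, h2⟩
        by_contra hne
        exact hx S' h1 S hS hne ⟨h2, hxS⟩
      · rintro rfl
        exact ⟨hS, hxS⟩
    · rw [Finset.card_eq_zero, Finset.filter_eq_empty_iff]
      intro S hS hxS
      exact h (hsub S hS hxS)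
  have key := mainQ_all _ V rfl _ (PhiU φ T) (PhiU_isAdd T hψ) (F.val.map mf) {M} hX
    (by simpa using hM) hcnt
  rw [PhiU_sum T _ hX, PhiU_sum T _ (by simpa using hM), AddCon.eq] at key
  have key := (key 0).2
  rw [add_zero, add_zero] at key
  have hG : Good φ T {M} := by
    refine ⟨by simpa using hM, Filter.Eventually.of_forall fun x => ?_, ?_⟩
    · simp only [cnt, Multiset.map_singleton, Multiset.sum_singleton]
      split_ifs <;> simp
    · simp only [Multiset.map_singleton, Multiset.toFinset_singleton, hMT]
      exact Relation.ReflTransGen.refl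
  have := (key hG).2.2
  have e : ((F.val.map mf).map (fun M => φ '' hull M)).toFinset = F := by
    rw [Multiset.map_map]
    have : F.val.map ((fun M => φ '' hull M) ∘ mf) = F.val.map id :=
      Multiset.map_congr rfl (fun S hS => (hmf S hS).2)
    rw [this, Multiset.map_id, Finset.val_toFinset]
  rwa [e] at this

theorem final {n : ℕ} (T : Set (Euc N)) (hT : IsSimplex n T) (F : Finset (Set (Euc N)))
    (hF : IsTriangulation n T F) : MoveEquiv n F {T} := by
  obtain ⟨v, hv, hvT⟩ := id hT
  have hn : Module.finrank ℝ (vectorSpan ℝ (range v)) = n := hv.finrank_vectorSpan (by simp)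
  obtain ⟨p, hp⟩ : ∃ p : Euc N →ₗ[ℝ] vectorSpan ℝ (range v),
      p ∘ₗ (vectorSpan ℝ (range v)).subtype = LinearMap.id :=
    LinearMap.exists_leftInverse_of_injective _ (Submodule.ker_subtype _)
  have hp' : ∀ x : vectorSpan ℝ (range v), p (x : Euc N) = x := fun x =>
    congrArg (fun g => g x) hp
  let φ : vectorSpan ℝ (range v) →ᵃ[ℝ] Euc N :=
    (vectorSpan ℝ (range v)).subtype.toAffineMap + AffineMap.const ℝ _ (v 0)
  let ψ : Euc N →ᵃ[ℝ] vectorSpan ℝ (range v) := p.toAffineMap - AffineMap.const ℝ _ (p (v 0))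
  have hψ : ∀ x, ψ (φ x) = x := by
    intro x
    simp [φ, ψ, hp']
  have hTr : T ⊆ range φ := by
    rw [hvT]
    refine (convexHull_subset_affineSpan _).trans ?_
    intro z hz
    have h0 : v 0 ∈ affineSpan ℝ (range v) := subset_affineSpan ℝ _ (mem_range_self 0)
    have := AffineSubspace.vsub_mem_direction hz h0
    rw [direction_affineSpan] at this
    exact ⟨⟨_, this⟩, by simp [φ]⟩
  have := core (F := F) hψ (by rw [hn]; exact hT) hTr (by rw [hn]; exact hF)
  rwa [hn] at this

end P8
end Star

/-- a starring of an `n`-simplex is equivalent by elementary moves to the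
trivial triangulation. -/
theorem starring_of_simplex_equiv_trivial {N n : ℕ} (T : Set (Euc N)) (hT : IsSimplex n T)
    (a : Euc N) (ha : a ∈ T) (F : Finset (Set (Euc N))) (hF : IsStarring n T a F) :
    MoveEquiv n F ({T} : Finset (Set (Euc N))) := by
  exact Star.final T hT F hF.1
end
end
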